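/- Fix a natural number q ≥ 2 and t ∈ [0,1]. Then the intersection 𝓑̂(t,q) ∩ (0,∞) of the accumulation set of Lee–Yang zeros of the unrooted binary Cayley tree with the positive real axis equals: {1} if 0 ≤ t ≤ t₁(q); {𝒵_q(t)} if t₁(q) < t ≤ t₂(q); and ∅ if t₂(q) < t ≤ 1. Here 𝒵_q(t) = [(−27(q−1)²t⁴ + 18(q²−3q+2)t³ + (q²+14q−14)t² + 2(q−2)t + 1) − √((t−1)((q−1)t+1)(9(q−1)t²−(q−2)t−1)³)] / (8t((q−2)t+1)³). -/

import Mathlib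

noncomputable section

/-- The pair `(Z_n^0(z), Z_n^1(z))` of conditional partition functions of the
`q`-state Potts model on the depth-`n` rooted binary Cayley tree, in the
field-like variable `z` and temperature-like variable `t`. -/
def ZZpair (q : ℕ) (t : ℝ) : ℕ → ℂ → ℂ × ℂ
  | 0, z => (z⁻¹, 1)
  | n + 1, z =>
      (z⁻¹ * ((ZZpair q t n z).1 + ((q : ℂ) - 1) * (t : ℂ) * (ZZpair q t n z).2) ^ 2,
       ((t : ℂ) * (ZZpair q t n z).1 + (1 + ((q : ℂ) - 2) * (t : ℂ)) * (ZZpair q t n z).2) ^ 2)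

/-- The partition function `Ẑ_n(z)` of the `q`-state Potts model on the depth-`n`
unrooted binary Cayley tree (for `n ≥ 1`):
`Ẑ_n(z) = z⁻¹(Z_{n−1}^0 + (q−1)t·Z_{n−1}^1)³ + (q−1)(t·Z_{n−1}^0 + (1+(q−2)t)·Z_{n−1}^1)³`. -/
def Zunrooted (q : ℕ) (t : ℝ) (n : ℕ) (z : ℂ) : ℂ :=
  z⁻¹ * ((ZZpair q t (n - 1) z).1 + ((q : ℂ) - 1) * (t : ℂ) * (ZZpair q t (n - 1) z).2) ^ 3
    + ((q : ℂ) - 1) *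
      ((t : ℂ) * (ZZpair q t (n - 1) z).1
        + (1 + ((q : ℂ) - 2) * (t : ℂ)) * (ZZpair q t (n - 1) z).2) ^ 3

/-- The accumulation set `𝓑̂(t,q)` of the Lee–Yang zeros of the unrooted binary
Cayley tree: the closure of the set of zeros of some `Ẑ_n`, `n ≥ 1`, in `ℂ ∖ {0}`. -/
def BLYhat (t : ℝ) (q : ℕ) : Set ℂ :=
  closure {z : ℂ | z ≠ 0 ∧ ∃ n : ℕ, 1 ≤ n ∧ Zunrooted q t n z = 0}

/-- The positive real axis `(0,∞)` viewed as a subset of `ℂ`. -/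
def posAxis : Set ℂ := {z : ℂ | ∃ x : ℝ, 0 < x ∧ z = (x : ℂ)}

/-- `t₁(q) = 1/(1+q)`. -/
def tOne (q : ℝ) : ℝ := 1 / (1 + q)

/-- `t₂(q) = (q − 2 + √(q² + 32q − 32))/(18(q − 1))`. -/
def tTwo (q : ℝ) : ℝ := (q - 2 + Real.sqrt (q ^ 2 + 32 * q - 32)) / (18 * (q - 1))

/-- `𝒵_q(t)`, the point at which the Lee–Yang zeros accumulate
when `t₁(q) < t ≤ t₂(q)`. -/
def calZ (q t : ℝ) : ℝ :=
  ((-27 * (q - 1) ^ 2 * t ^ 4 + 18 * (q ^ 2 - 3 * q + 2) * t ^ 3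
      + (q ^ 2 + 14 * q - 14) * t ^ 2 + 2 * (q - 2) * t + 1)
    - Real.sqrt ((t - 1) * ((q - 1) * t + 1) * (9 * (q - 1) * t ^ 2 - (q - 2) * t - 1) ^ 3))
    / (8 * t * ((q - 2) * t + 1) ^ 3)

/-- A nonvanishing holomorphic function on a ball has a holomorphic logarithm. -/
theorem exists_holomorphic_log {p : ℂ} {R : ℝ} (hR : 0 < R) {Y : ℂ → ℂ}
    (hY : DifferentiableOn ℂ Y (Metric.ball p R)) (h0 : ∀ z ∈ Metric.ball p R, Y z ≠ 0)
    {w : ℂ} (hw : Complex.exp w = Y p) :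
    ∃ l : ℂ → ℂ, DifferentiableOn ℂ l (Metric.ball p R) ∧ l p = w ∧
      ∀ z ∈ Metric.ball p R, Complex.exp (l z) = Y z := by
  have hf : DifferentiableOn ℂ (fun z => deriv Y z / Y z) (Metric.ball p R) :=
    (hY.deriv Metric.isOpen_ball).div hY h0
  obtain ⟨l, hlp, hl⟩ := hf.isExactOn_ball.with_val_at p w
  have hld : DifferentiableOn ℂ l (Metric.ball p R) := fun z hz =>
    (hl z hz).differentiableAt.differentiableWithinAt
  refine ⟨l, hld, hlp, fun z hz => ?_⟩
  have hp : p ∈ Metric.ball p R := Metric.mem_ball_self hR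
  have key : Complex.exp (l z) / Y z = Complex.exp (l p) / Y p := by
    refine Metric.isOpen_ball.is_const_of_deriv_eq_zero (𝕜 := ℂ)
      (f := fun z => Complex.exp (l z) / Y z)
      (convex_ball p R).isPreconnected (hld.cexp.div hY h0) (fun x hx => ?_) hz hp
    have h1 : HasDerivAt Y (deriv Y x) x :=
      (hY.differentiableAt (Metric.isOpen_ball.mem_nhds hx)).hasDerivAt
    have h2 := ((hl x hx).cexp.div h1 (h0 x hx)).deriv
    have h3 := h0 x hx
    change deriv (fun z => Complex.exp (l z) / Y z) x = 0
    refine h2.trans ?_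
    field_simp
    simp
  rw [hlp, hw, div_self (h0 p hp), div_eq_one_iff_eq (h0 z hz)] at key
  exact key

/-- A pointwise limit along a nontrivial filter of uniformly bounded holomorphic functions on a
ball is holomorphic. -/
theorem differentiableOn_of_tendsto_of_bounded {ι : Type*} {U : Filter ι} [U.NeBot]
    {p : ℂ} {R M : ℝ} {f : ι → ℂ → ℂ} {g : ℂ → ℂ}
    (hf : ∀ n, DifferentiableOn ℂ (f n) (Metric.ball p R))
    (hM : ∀ n, ∀ z ∈ Metric.ball p R, ‖f n z‖ ≤ M)
    (hg : ∀ z ∈ Metric.ball p R, Filter.Tendsto (fun n => f n z) U (nhds (g z))) :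
    DifferentiableOn ℂ g (Metric.ball p R) := by
  refine TendstoLocallyUniformlyOn.differentiableOn (F := f) (φ := U) ?_
    (Filter.Eventually.of_forall hf) Metric.isOpen_ball
  rw [Metric.tendstoLocallyUniformlyOn_iff]
  intro ε hε x hx
  obtain ⟨r, hr, hrs⟩ := Metric.isOpen_ball.mem_nhds hx |> Metric.mem_nhds_iff.1
  have hne : Nonempty ι := U.nonempty_of_neBot
  have hM0 : 0 ≤ M := (norm_nonneg _).trans (hM (Classical.arbitrary ι) x hx)
  have lip : ∀ n, ∀ z ∈ Metric.ball x r, dist (f n z) (f n x) ≤ (2 * M + 1) / r * dist z x := by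
    intro n z hz
    refine Complex.dist_le_div_mul_dist_of_mapsTo_ball ((hf n).mono hrs) (fun y hy => ?_) hz
    rw [Metric.mem_closedBall, dist_eq_norm]
    have := norm_sub_le (f n y) (f n x)
    linarith [hM n y (hrs hy), hM n x hx]
  have lipg : ∀ z ∈ Metric.ball x r, dist (g z) (g x) ≤ (2 * M + 1) / r * dist z x := by
    intro z hz
    exact le_of_tendsto ((hg z (hrs hz)).dist (hg x hx))
      (Filter.Eventually.of_forall fun n => lip n z hz)
  have hL : 0 < (2 * M + 1) / r := by positivity
  set L := (2 * M + 1) / r with hLdef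
  refine ⟨Metric.ball x (min r (ε / (3 * L))), mem_nhdsWithin_of_mem_nhds
    (Metric.ball_mem_nhds _ (by positivity)), ?_⟩
  have hε3 : 0 < ε / 3 := by positivity
  filter_upwards [(Metric.tendsto_nhds.1 (hg x hx)) _ hε3] with n hn y hy
  have hy1 : y ∈ Metric.ball x r := Metric.ball_subset_ball (min_le_left _ _) hy
  have hy2 : dist y x < ε / (3 * L) := lt_of_lt_of_le hy (min_le_right _ _)
  have hy3 : L * dist y x < ε / 3 := by
    rw [lt_div_iff₀ (by positivity)] at hy2
    linarith
  have := dist_triangle4 (g y) (g x) (f n x) (f n y)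
  have h1 := lip n y hy1
  have h2 := lipg y hy1
  rw [dist_comm] at hn h1
  linarith

/-- A uniformly bounded sequence of holomorphic functions on a ball converges pointwise along any
ultrafilter to a holomorphic function. -/
theorem exists_ultrafilter_limit {ι : Type*} (U : Ultrafilter ι)
    {p : ℂ} {R M : ℝ} {f : ι → ℂ → ℂ}
    (hf : ∀ n, DifferentiableOn ℂ (f n) (Metric.ball p R))
    (hM : ∀ n, ∀ z ∈ Metric.ball p R, ‖f n z‖ ≤ M) :
    ∃ g : ℂ → ℂ, DifferentiableOn ℂ g (Metric.ball p R) ∧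
      ∀ z ∈ Metric.ball p R, Filter.Tendsto (fun n => f n z) U (nhds (g z)) := by
  have : ∀ z, ∃ w, z ∈ Metric.ball p R → Filter.Tendsto (fun n => f n z) U (nhds w) := by
    intro z
    by_cases hz : z ∈ Metric.ball p R
    · obtain ⟨w, -, hw⟩ := (isCompact_closedBall (0 : ℂ) M).ultrafilter_le_nhds
        (U.map fun n => f n z) (by
          have : ∀ᶠ n in (U : Filter ι), f n z ∈ Metric.closedBall (0 : ℂ) M :=
            Filter.Eventually.of_forall fun n => by simpa using hM n z hz
          exact Filter.le_principal_iff.2 this)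
      exact ⟨w, fun _ => hw⟩
    · exact ⟨0, fun h => absurd h hz⟩
  choose g hg using this
  exact ⟨g, differentiableOn_of_tendsto_of_bounded hf hM hg, hg⟩

/-- A holomorphic logarithm that is real at the centre of an interval on which its exponential is
positive is real on the whole interval. -/
theorem log_im_eq_zero_of_exp_pos {p R : ℝ} {l : ℂ → ℂ}
    (hl : ContinuousOn l (Metric.ball (p : ℂ) R)) (hp : (l p).im = 0)
    (hpos : ∀ x : ℝ, (x : ℂ) ∈ Metric.ball (p : ℂ) R →
      ∃ y : ℝ, 0 < y ∧ Complex.exp (l x) = y) :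
    ∀ x : ℝ, (x : ℂ) ∈ Metric.ball (p : ℂ) R → (l x).im = 0 := by
  intro x hx
  have hR : 0 < R := lt_of_le_of_lt dist_nonneg hx
  have hball : ∀ y : ℝ, (y : ℂ) ∈ Metric.ball (p : ℂ) R ↔ y ∈ Metric.ball p R := by
    intro y
    rw [Metric.mem_ball, Metric.mem_ball, Complex.dist_eq, Real.dist_eq, ← Complex.ofReal_sub,
      Complex.norm_real, Real.norm_eq_abs]
  have cont : ContinuousOn (fun y : ℝ => (l y).im) (Metric.ball p R) :=
    Complex.continuous_im.comp_continuousOn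
      (hl.comp Complex.continuous_ofReal.continuousOn fun y hy => (hball y).2 hy)
  have hconn : IsPreconnected ((fun y : ℝ => (l y).im) '' Metric.ball p R) :=
    (convex_ball p R).isPreconnected.image _ cont
  have sin0 : ∀ y ∈ (fun y : ℝ => (l y).im) '' Metric.ball p R,
      Real.sin y = 0 ∧ 0 < Real.cos y := by
    rintro _ ⟨y, hy, rfl⟩
    obtain ⟨v, hv, h⟩ := hpos y ((hball y).2 hy)
    have h1 := congrArg Complex.im h
    have h2 := congrArg Complex.re h
    rw [Complex.exp_im, Complex.ofReal_im] at h1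
    rw [Complex.exp_re, Complex.ofReal_re] at h2
    have he := Real.exp_pos (l y).re
    refine ⟨?_, ?_⟩
    · simpa [he.ne'] using h1
    · rw [← h2] at hv
      exact (pos_iff_pos_of_mul_pos hv).1 he
  have hord := hconn.ordConnected
  have m0 : (0 : ℝ) ∈ (fun y : ℝ => (l y).im) '' Metric.ball p R :=
    ⟨p, Metric.mem_ball_self hR, hp⟩
  have mx : (l x).im ∈ (fun y : ℝ => (l y).im) '' Metric.ball p R := ⟨x, (hball x).1 hx, rfl⟩
  by_contra hne
  have hpi := Real.pi_pos
  rcases lt_or_gt_of_ne hne with h | h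
  · have hmem : max (l x).im (-(Real.pi / 2)) ∈ (fun y : ℝ => (l y).im) '' Metric.ball p R :=
      hord.out mx m0 ⟨le_max_left _ _, max_le h.le (by linarith)⟩
    have := (sin0 _ hmem).1
    have h2 := Real.sin_neg_of_neg_of_neg_pi_lt (x := max (l x).im (-(Real.pi / 2)))
      (max_lt h (by linarith)) (lt_of_lt_of_le (by linarith) (le_max_right _ _))
    linarith
  · have hmem : min (l x).im (Real.pi / 2) ∈ (fun y : ℝ => (l y).im) '' Metric.ball p R :=
      hord.out m0 mx ⟨le_min h.le (by linarith), min_le_left _ _⟩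
    have := (sin0 _ hmem).1
    have h2 := Real.sin_pos_of_pos_of_lt_pi (x := min (l x).im (Real.pi / 2))
      (lt_min h (by linarith)) (lt_of_le_of_lt (min_le_right _ _) (by linarith))
    linarith

/-- Two holomorphic functions on a ball with real centre that agree at the real points of the ball
agree. -/
theorem eqOn_ball_of_eq_on_reals {p R : ℝ} {f g : ℂ → ℂ}
    (hf : DifferentiableOn ℂ f (Metric.ball (p : ℂ) R))
    (hg : DifferentiableOn ℂ g (Metric.ball (p : ℂ) R))
    (h : ∀ x : ℝ, (x : ℂ) ∈ Metric.ball (p : ℂ) R → f x = g x) :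
    Set.EqOn f g (Metric.ball (p : ℂ) R) := by
  intro z hz
  have hR : 0 < R := lt_of_le_of_lt dist_nonneg hz
  refine (hf.analyticOnNhd Metric.isOpen_ball).eqOn_of_preconnected_of_frequently_eq
    (hg.analyticOnNhd Metric.isOpen_ball) (convex_ball _ _).isPreconnected
    (Metric.mem_ball_self hR) ?_ hz
  have ht : Filter.Tendsto (fun x : ℝ => (x : ℂ)) (nhdsWithin p {p}ᶜ)
      (nhdsWithin (p : ℂ) {(p : ℂ)}ᶜ) := by
    refine tendsto_nhdsWithin_of_tendsto_nhds_of_eventually_within _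
      (Complex.continuous_ofReal.continuousAt.tendsto.mono_left nhdsWithin_le_nhds) ?_
    filter_upwards [self_mem_nhdsWithin] with x hx
    simpa using hx
  refine ht.frequently (Filter.Eventually.frequently ?_)
  filter_upwards [(Complex.continuous_ofReal.continuousAt.tendsto.mono_left
    nhdsWithin_le_nhds).eventually (Metric.isOpen_ball.mem_nhds (Metric.mem_ball_self hR))]
    with x hx using h x hx

/-- Borel–Carathéodory on the half-size ball. -/
theorem norm_le_of_re_le {p : ℂ} {R M N : ℝ} (hR : 0 < R) (hM : 0 < M) {f : ℂ → ℂ}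
    (hf : DifferentiableOn ℂ f (Metric.ball p R))
    (hre : ∀ z ∈ Metric.ball p R, (f z).re ≤ M) (hN : ‖f p‖ ≤ N) :
    ∀ z ∈ Metric.ball p (R / 2), ‖f z‖ ≤ 2 * M + 3 * N := by
  intro z hz
  have hmaps : ∀ w ∈ Metric.ball (0 : ℂ) R, p + w ∈ Metric.ball p R := by
    intro w hw
    simpa [dist_eq_norm] using hw
  have hd : DifferentiableOn ℂ (fun w => f (p + w)) (Metric.ball 0 R) :=
    hf.comp (by fun_prop) hmaps
  have hw : ‖z - p‖ < R / 2 := by simpa [dist_eq_norm] using hz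
  have hw' : z - p ∈ Metric.ball (0 : ℂ) R := by
    rw [mem_ball_zero_iff]
    linarith
  have := Complex.borelCaratheodory hM hd (fun w hw => hre _ (hmaps w hw)) hR hw'
  simp only [add_sub_cancel, add_zero] at this
  have hpos : 0 < R - ‖z - p‖ := by linarith
  refine this.trans (add_le_add ?_ ?_)
  · rw [div_le_iff₀ hpos]
    nlinarith
  · rw [div_le_iff₀ hpos]
    nlinarith [norm_nonneg (f p), norm_nonneg (z - p)]

/-- The growth hypotheses on a sequence `Z n` of holomorphic homogeneous coordinates and on
associated zero-free holomorphic functions `Y n`, under which `Z n` can be renormalised to a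
nondegenerate holomorphic limit. -/
structure ZeroFreeGrowth (p R K : ℝ) (Z : ℕ → ℂ → ℂ × ℂ) (Y : ℕ → ℂ → ℂ) : Prop where
  radius_pos : 0 < R
  const_nonneg : 0 ≤ K
  fst_holo : ∀ n, DifferentiableOn ℂ (fun z => (Z n z).1) (Metric.ball (p : ℂ) R)
  snd_holo : ∀ n, DifferentiableOn ℂ (fun z => (Z n z).2) (Metric.ball (p : ℂ) R)
  holo : ∀ n, DifferentiableOn ℂ (Y n) (Metric.ball (p : ℂ) R)
  ne_zero : ∀ n, ∀ z ∈ Metric.ball (p : ℂ) R, Y n z ≠ 0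
  coord_ne_zero : ∀ n, ∀ z ∈ Metric.ball (p : ℂ) R, Z n z ≠ 0
  initial : ∀ z ∈ Metric.ball (p : ℂ) R, |Real.log ‖Z 0 z‖| ≤ K
  step : ∀ n, ∀ z ∈ Metric.ball (p : ℂ) R,
    |Real.log ‖Z (n + 1) z‖ - 2 * Real.log ‖Z n z‖| ≤ K
  upper : ∀ n, ∀ z ∈ Metric.ball (p : ℂ) R, Real.log ‖Y n z‖ ≤ 3 * Real.log ‖Z n z‖ + K
  lower_or : ∀ n, ∀ z ∈ Metric.ball (p : ℂ) R, 3 * Real.log ‖Z n z‖ - K ≤ Real.log ‖Y n z‖ ∨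
    6 * Real.log ‖Z n z‖ - K ≤ Real.log ‖Y (n + 1) z‖
  real_pos : ∀ n, ∀ x : ℝ, (x : ℂ) ∈ Metric.ball (p : ℂ) R → ∃ y : ℝ, 0 < y ∧ Y n x = y
  real_lower : ∀ n, ∀ x : ℝ, (x : ℂ) ∈ Metric.ball (p : ℂ) R →
    3 * Real.log ‖Z n x‖ - K ≤ Real.log ‖Y n x‖

/-- The free energy of the coordinates: the limit of `2⁻ⁿ log ‖Z n z‖`, with its rate of
convergence. -/
theorem ZeroFreeGrowth.exists_green {p R K : ℝ} {Z : ℕ → ℂ → ℂ × ℂ} {Y : ℕ → ℂ → ℂ}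
    (H : ZeroFreeGrowth p R K Z Y) : ∃ G : ℂ → ℝ, ∀ z ∈ Metric.ball (p : ℂ) R, ∀ n,
      |Real.log ‖Z n z‖ / 2 ^ n - G z| ≤ K / 2 ^ n := by
  have : ∀ z, ∃ g : ℝ, z ∈ Metric.ball (p : ℂ) R → ∀ n,
      |Real.log ‖Z n z‖ / 2 ^ n - g| ≤ K / 2 ^ n := by
    intro z
    by_cases hz : z ∈ Metric.ball (p : ℂ) R
    · have hd : ∀ n, dist (Real.log ‖Z n z‖ / 2 ^ n) (Real.log ‖Z (n + 1) z‖ / 2 ^ (n + 1)) ≤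
          K / 2 / 2 ^ n := by
        intro n
        rw [dist_comm, Real.dist_eq, pow_succ]
        have h2 : (0 : ℝ) < 2 ^ n := by positivity
        have : Real.log ‖Z (n + 1) z‖ / (2 ^ n * 2) - Real.log ‖Z n z‖ / 2 ^ n =
            (Real.log ‖Z (n + 1) z‖ - 2 * Real.log ‖Z n z‖) / (2 * 2 ^ n) := by
          field_simp
        rw [this, abs_div, abs_of_pos (by positivity : (0 : ℝ) < 2 * 2 ^ n), div_div]
        gcongr
        exact H.step n z hz
      obtain ⟨g, hg⟩ := cauchySeq_tendsto_of_complete (cauchySeq_of_le_geometric_two hd)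
      exact ⟨g, fun _ n => dist_le_of_le_geometric_two_of_tendsto hd hg n⟩
    · exact ⟨0, fun h => absurd h hz⟩
  choose G hG using this
  exact ⟨G, hG⟩

theorem ZeroFreeGrowth.exists_log {p R K : ℝ} {Z : ℕ → ℂ → ℂ × ℂ} {Y : ℕ → ℂ → ℂ}
    (H : ZeroFreeGrowth p R K Z Y) (n : ℕ) : ∃ φ : ℂ → ℂ,
      DifferentiableOn ℂ φ (Metric.ball (p : ℂ) R) ∧
      (∀ z ∈ Metric.ball (p : ℂ) R, (φ z).re = Real.log ‖Y n z‖ / (3 * 2 ^ n)) ∧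
      ∀ x : ℝ, (x : ℂ) ∈ Metric.ball (p : ℂ) R → (φ x).im = 0 := by
  have hp : (p : ℂ) ∈ Metric.ball (p : ℂ) R := Metric.mem_ball_self H.radius_pos
  obtain ⟨y, hy, hYy⟩ := H.real_pos n p hp
  obtain ⟨l, hl, hlp, hexp⟩ := exists_holomorphic_log H.radius_pos (H.holo n) (H.ne_zero n)
    (w := (Real.log y : ℂ)) (by rw [← Complex.ofReal_exp, Real.exp_log hy, hYy])
  have him := log_im_eq_zero_of_exp_pos hl.continuousOn (by rw [hlp, Complex.ofReal_im])
    (fun x hx => by rw [hexp _ hx]; exact H.real_pos n x hx)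
  have hcast : ((3 * 2 ^ n : ℝ) : ℂ) = 3 * 2 ^ n := by push_cast; ring
  refine ⟨fun z => l z / ((3 * 2 ^ n : ℝ) : ℂ), hl.div_const _, fun z hz => ?_, fun x hx => ?_⟩
  · rw [Complex.div_ofReal_re, ← hexp z hz, Complex.norm_exp, Real.log_exp]
  · rw [Complex.div_ofReal_im, him x hx, zero_div]

/-- The limit of the normalised logarithms of `Y n` is a holomorphic function whose real part is
the free energy of the coordinates. -/
theorem ZeroFreeGrowth.exists_potential {p R K : ℝ} {Z : ℕ → ℂ → ℂ × ℂ} {Y : ℕ → ℂ → ℂ}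
    (H : ZeroFreeGrowth p R K Z Y) : ∃ Φ : ℂ → ℂ,
      DifferentiableOn ℂ Φ (Metric.ball (p : ℂ) (R / 2)) ∧
      ∀ z ∈ Metric.ball (p : ℂ) (R / 2), ∀ n,
        |Real.log ‖Z n z‖ - 2 ^ n * (Φ z).re| ≤ K := by
  obtain ⟨G, hG⟩ := H.exists_green
  choose φ hφ hre him using H.exists_log
  have hR := H.radius_pos
  have hK := H.const_nonneg
  have hp : (p : ℂ) ∈ Metric.ball (p : ℂ) R := Metric.mem_ball_self hR
  have hsub : Metric.ball (p : ℂ) (R / 2) ⊆ Metric.ball (p : ℂ) R :=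
    Metric.ball_subset_ball (by linarith)
  have pow1 : ∀ n : ℕ, (1 : ℝ) ≤ 2 ^ n := fun n => one_le_pow₀ (by norm_num)
  have hKn : ∀ n : ℕ, K / 2 ^ n ≤ K := fun n => div_le_self hK (pow1 n)
  have hh : ∀ z ∈ Metric.ball (p : ℂ) R, ∀ n, |Real.log ‖Z n z‖ / 2 ^ n| ≤ 3 * K := by
    intro z hz n
    have h0 := hG z hz 0
    have h1 := hG z hz n
    have h2 := H.initial z hz
    have h3 := hKn n
    simp only [pow_zero, div_one] at h0
    rw [abs_le] at *
    constructor <;> linarith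
  have up : ∀ n, ∀ z ∈ Metric.ball (p : ℂ) R,
      (φ n z).re ≤ Real.log ‖Z n z‖ / 2 ^ n + K / 2 ^ n := by
    intro n z hz
    rw [hre n z hz, ← add_div, div_le_div_iff₀ (by positivity) (by positivity)]
    have := H.upper n z hz
    have h2 : (0 : ℝ) < 2 ^ n := by positivity
    nlinarith
  have lo : ∀ n, ∀ x : ℝ, (x : ℂ) ∈ Metric.ball (p : ℂ) R →
      Real.log ‖Z n x‖ / 2 ^ n - K / 2 ^ n ≤ (φ n x).re := by
    intro n x hx
    rw [hre n x hx, ← sub_div, div_le_div_iff₀ (by positivity) (by positivity)]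
    have := H.real_lower n x hx
    have h2 : (0 : ℝ) < 2 ^ n := by positivity
    nlinarith
  have lo_or : ∀ n, ∀ z ∈ Metric.ball (p : ℂ) R,
      Real.log ‖Z n z‖ / 2 ^ n - K / 2 ^ n ≤ max (φ n z).re (φ (n + 1) z).re := by
    intro n z hz
    have h2 : (0 : ℝ) < 2 ^ n := by positivity
    rcases H.lower_or n z hz with h | h
    · refine le_max_of_le_left ?_
      rw [hre n z hz, ← sub_div, div_le_div_iff₀ (by positivity) (by positivity)]
      nlinarith
    · refine le_max_of_le_right ?_
      rw [hre (n + 1) z hz, ← sub_div, div_le_div_iff₀ (by positivity) (by positivity), pow_succ]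
      nlinarith
  have bdd : ∀ n, ∀ z ∈ Metric.ball (p : ℂ) (R / 2), ‖φ n z‖ ≤ 2 * (4 * K + 1) + 3 * (4 * K) := by
    intro n
    refine norm_le_of_re_le hR (by linarith) (hφ n) (fun z hz => ?_) ?_
    · have h1 := up n z hz
      have h2 := (abs_le.1 (hh z hz n)).2
      linarith [hKn n]
    · have h1 := up n p hp
      have h2 := lo n p hp
      have h3 := abs_le.1 (hh p hp n)
      have h4 : φ n p = ((φ n p).re : ℂ) := by
        apply Complex.ext <;> simp [him n p hp]
      rw [h4, Complex.norm_real, Real.norm_eq_abs, abs_le]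
      constructor <;> linarith [hKn n]
  set U : Ultrafilter ℕ := Filter.hyperfilter ℕ with hU
  have hUle : (U : Filter ℕ) ≤ Filter.atTop := Nat.hyperfilter_le_atTop
  obtain ⟨Φ, hΦ, hlim⟩ := exists_ultrafilter_limit U (fun n => (hφ n).mono hsub) bdd
  obtain ⟨Ψ, hΨ, hlim'⟩ := exists_ultrafilter_limit U (f := fun n => φ (n + 1))
    (fun n => (hφ (n + 1)).mono hsub) (fun n => bdd (n + 1))
  have hK0 : Filter.Tendsto (fun n : ℕ => K / (2 : ℝ) ^ n) Filter.atTop (nhds 0) :=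
    tendsto_const_nhds.div_atTop (tendsto_pow_atTop_atTop_of_one_lt one_lt_two)
  have hGlim : ∀ z ∈ Metric.ball (p : ℂ) R,
      Filter.Tendsto (fun n => Real.log ‖Z n z‖ / 2 ^ n) Filter.atTop (nhds (G z)) := by
    intro z hz
    rw [tendsto_iff_dist_tendsto_zero]
    exact squeeze_zero (fun _ => dist_nonneg) (hG z hz) hK0
  have hGp : ∀ z ∈ Metric.ball (p : ℂ) R, Filter.Tendsto
      (fun n => Real.log ‖Z n z‖ / 2 ^ n + K / 2 ^ n) Filter.atTop (nhds (G z)) := by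
    intro z hz
    simpa using (hGlim z hz).add hK0
  have hGm : ∀ z ∈ Metric.ball (p : ℂ) R, Filter.Tendsto
      (fun n => Real.log ‖Z n z‖ / 2 ^ n - K / 2 ^ n) Filter.atTop (nhds (G z)) := by
    intro z hz
    simpa using (hGlim z hz).sub hK0
  have shift := Filter.tendsto_add_atTop_nat 1
  have le1 : ∀ z ∈ Metric.ball (p : ℂ) (R / 2), (Φ z).re ≤ G z := fun z hz =>
    le_of_tendsto_of_tendsto ((Complex.continuous_re.tendsto _).comp (hlim z hz))
      ((hGp z (hsub hz)).mono_left hUle) (Filter.Eventually.of_forall fun n => up n z (hsub hz))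
  have hmax : ∀ z ∈ Metric.ball (p : ℂ) (R / 2), G z ≤ max (Φ z).re (Ψ z).re := fun z hz =>
    le_of_tendsto_of_tendsto ((hGm z (hsub hz)).mono_left hUle)
      (((Complex.continuous_re.tendsto _).comp (hlim z hz)).max
        ((Complex.continuous_re.tendsto _).comp (hlim' z hz)))
      (Filter.Eventually.of_forall fun n => lo_or n z (hsub hz))
  have heq : Set.EqOn Φ Ψ (Metric.ball (p : ℂ) (R / 2)) := by
    refine eqOn_ball_of_eq_on_reals hΦ hΨ fun x hx => ?_
    have hx' := hsub hx
    have hre1 : Filter.Tendsto (fun n => (φ n x).re) Filter.atTop (nhds (G x)) :=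
      tendsto_of_tendsto_of_tendsto_of_le_of_le (hGm x hx') (hGp x hx')
        (fun n => lo n x hx') (fun n => up n x hx')
    have e1 := tendsto_nhds_unique ((Complex.continuous_re.tendsto _).comp (hlim x hx))
      (hre1.mono_left hUle)
    have e2 := tendsto_nhds_unique ((Complex.continuous_re.tendsto _).comp (hlim' x hx))
      ((hre1.comp shift).mono_left hUle)
    have e3 : (Φ x).im = 0 := tendsto_nhds_unique
      ((Complex.continuous_im.tendsto _).comp (hlim x hx))
      (tendsto_const_nhds.congr fun n => (him n x hx').symm)
    have e4 : (Ψ x).im = 0 := tendsto_nhds_unique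
      ((Complex.continuous_im.tendsto _).comp (hlim' x hx))
      (tendsto_const_nhds.congr fun n => (him (n + 1) x hx').symm)
    exact Complex.ext (e1.trans e2.symm) (e3.trans e4.symm)
  refine ⟨Φ, hΦ, fun z hz n => ?_⟩
  have hGΦ : (Φ z).re = G z := by
    refine le_antisymm (le1 z hz) ?_
    have := hmax z hz
    rwa [← heq hz, max_self] at this
  have := hG z (hsub hz) n
  have h2 : (0 : ℝ) < 2 ^ n := by positivity
  have e : Real.log ‖Z n z‖ - 2 ^ n * (Φ z).re = 2 ^ n * (Real.log ‖Z n z‖ / 2 ^ n - G z) := by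
    rw [hGΦ]
    field_simp
  rw [e, abs_mul, abs_of_pos h2]
  calc 2 ^ n * |Real.log ‖Z n z‖ / 2 ^ n - G z| ≤ 2 ^ n * (K / 2 ^ n) := by gcongr
    _ = K := by field_simp

/-- After a holomorphic renormalisation, the coordinates `Z n` converge along an ultrafilter to
holomorphic functions without common zeros. -/
theorem ZeroFreeGrowth.exists_limit {p R K : ℝ} {Z : ℕ → ℂ → ℂ × ℂ} {Y : ℕ → ℂ → ℂ}
    (H : ZeroFreeGrowth p R K Z Y) : ∃ (A B : ℂ → ℂ) (s : ℕ → ℂ → ℂ),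
      DifferentiableOn ℂ A (Metric.ball (p : ℂ) (R / 2)) ∧
      DifferentiableOn ℂ B (Metric.ball (p : ℂ) (R / 2)) ∧
      ∀ z ∈ Metric.ball (p : ℂ) (R / 2), (A z ≠ 0 ∨ B z ≠ 0) ∧
        Filter.Tendsto (fun n => s n z * (Z n z).1) (Filter.hyperfilter ℕ) (nhds (A z)) ∧
        Filter.Tendsto (fun n => s n z * (Z n z).2) (Filter.hyperfilter ℕ) (nhds (B z)) := by
  obtain ⟨Φ, hΦ, hb⟩ := H.exists_potential
  have hR := H.radius_pos
  have hsub : Metric.ball (p : ℂ) (R / 2) ⊆ Metric.ball (p : ℂ) R :=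
    Metric.ball_subset_ball (by linarith)
  set s : ℕ → ℂ → ℂ := fun n z => Complex.exp (-(2 ^ n * Φ z)) with hs
  have hsd : ∀ n, DifferentiableOn ℂ (s n) (Metric.ball (p : ℂ) (R / 2)) := fun n =>
    ((hΦ.const_mul _).neg).cexp
  have hsn : ∀ n z, ‖s n z‖ = Real.exp (-(2 ^ n * (Φ z).re)) := by
    intro n z
    rw [hs, Complex.norm_exp, Complex.neg_re]
    have : ((2 : ℂ) ^ n * Φ z).re = 2 ^ n * (Φ z).re := by
      have : ((2 : ℂ) ^ n) = ((2 ^ n : ℝ) : ℂ) := by push_cast; ring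
      rw [this, Complex.re_ofReal_mul]
    rw [this]
  have hnorm : ∀ n, ∀ z ∈ Metric.ball (p : ℂ) (R / 2),
      Real.exp (-K) ≤ ‖s n z‖ * ‖Z n z‖ ∧ ‖s n z‖ * ‖Z n z‖ ≤ Real.exp K := by
    intro n z hz
    have hZ : 0 < ‖Z n z‖ := norm_pos_iff.2 (H.coord_ne_zero n z (hsub hz))
    have : ‖s n z‖ * ‖Z n z‖ = Real.exp (Real.log ‖Z n z‖ - 2 ^ n * (Φ z).re) := by
      rw [hsn, sub_eq_neg_add, Real.exp_add, Real.exp_log hZ]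
    rw [this, Real.exp_le_exp, Real.exp_le_exp]
    exact abs_le.1 (hb z hz n)
  obtain ⟨A, hA, hAl⟩ := exists_ultrafilter_limit (Filter.hyperfilter ℕ)
    (f := fun n z => s n z * (Z n z).1) (M := Real.exp K)
    (fun n => (hsd n).mul ((H.fst_holo n).mono hsub)) (fun n z hz => by
      rw [norm_mul]
      exact le_trans (by gcongr; exact norm_fst_le _) (hnorm n z hz).2)
  obtain ⟨B, hB, hBl⟩ := exists_ultrafilter_limit (Filter.hyperfilter ℕ)
    (f := fun n z => s n z * (Z n z).2) (M := Real.exp K)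
    (fun n => (hsd n).mul ((H.snd_holo n).mono hsub)) (fun n z hz => by
      rw [norm_mul]
      exact le_trans (by gcongr; exact norm_snd_le _) (hnorm n z hz).2)
  refine ⟨A, B, s, hA, hB, fun z hz => ⟨?_, hAl z hz, hBl z hz⟩⟩
  have hm : Real.exp (-K) ≤ max ‖A z‖ ‖B z‖ := by
    refine ge_of_tendsto ((hAl z hz).norm.max (hBl z hz).norm)
      (Filter.Eventually.of_forall fun n => ?_)
    rw [norm_mul, norm_mul, ← mul_max_of_nonneg _ _ (norm_nonneg _)]
    exact (hnorm n z hz).1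
  by_contra hc
  push Not at hc
  rw [hc.1, hc.2, norm_zero, max_self] at hm
  exact absurd hm (not_le.2 (Real.exp_pos _))

theorem real_coeffs_eq_zero_of_root {e : ℂ} (he : e ^ 2 = e - 1) {α β : ℝ}
    (h : (α : ℂ) * e + β = 0) : α = 0 ∧ β = 0 := by
  have him := congrArg Complex.im h
  have hre := congrArg Complex.re h
  have h2 := congrArg Complex.im he
  have h1 := congrArg Complex.re he
  simp [pow_two] at him hre h2 h1
  have hne : e.im ≠ 0 := by
    intro h0
    rw [h0] at h1
    nlinarith [sq_nonneg (e.re - 1 / 2)]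
  have hα : α = 0 := by
    rcases him with h | h
    · exact h
    · exact absurd h hne
  refine ⟨hα, ?_⟩
  simpa [hα] using hre

theorem cube_ne_cube_of_cube_eq_neg {ρ b k t : ℝ} (hρ : 0 < ρ) (hb : 0 < b) (hk : 0 < k)
    (ht : 0 ≤ t) (hbt : 4 * t ^ 2 * k < b) {u : ℂ} (hu : u ^ 3 = -(ρ : ℂ) ^ 3) :
    ((k : ℂ) * (t * u - 1)) ^ 3 ≠ (u * (b * u - t * k)) ^ 3 := by
  intro h
  have hρc : (ρ : ℂ) ≠ 0 := by exact_mod_cast hρ.ne'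
  obtain ⟨e, rfl⟩ : ∃ e : ℂ, u = ρ * e := ⟨u / ρ, by field_simp⟩
  have he3 : e ^ 3 = -1 := by
    have : (ρ : ℂ) ^ 3 * (e ^ 3 + 1) = 0 := by linear_combination hu
    rcases mul_eq_zero.1 this with h | h
    · exact absurd h (pow_ne_zero _ hρc)
    · linear_combination h
  have hfac : (e + 1) * (e ^ 2 - e + 1) = 0 := by linear_combination he3
  rcases mul_eq_zero.1 hfac with he | he
  · have hem : e = -1 := by linear_combination he
    rw [hem] at h
    have hr : (k * (t * (ρ * -1) - 1)) ^ 3 = ((ρ * -1) * (b * (ρ * -1) - t * k)) ^ 3 := by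
      exact_mod_cast h
    have h1 : (k * (t * (ρ * -1) - 1)) ^ 3 < 0 := by
      refine Odd.pow_neg (by decide) ?_
      have : 0 ≤ t * ρ := by positivity
      nlinarith
    have h2 : 0 ≤ ((ρ * -1) * (b * (ρ * -1) - t * k)) ^ 3 := by
      have : (ρ * -1) * (b * (ρ * -1) - t * k) = ρ * (b * ρ + t * k) := by ring
      rw [this]
      positivity
    linarith
  · have hsq : e ^ 2 = e - 1 := by linear_combination he
    have hprod : ((k : ℂ) * (t * (ρ * e) - 1) - (ρ * e) * (b * (ρ * e) - t * k)) *
        ((((k : ℂ) * (t * (ρ * e) - 1)) + e * ((ρ * e) * (b * (ρ * e) - t * k))) *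
        (((k : ℂ) * (t * (ρ * e) - 1)) - e ^ 2 * ((ρ * e) * (b * (ρ * e) - t * k)))) = 0 := by
      set x := (k : ℂ) * (t * (ρ * e) - 1)
      set y := (ρ * e) * (b * (ρ * e) - t * k)
      linear_combination h - (x - y) * (x * y + y ^ 2 * (e + 1)) * hsq
    rcases mul_eq_zero.1 hprod with h | h
    · have := real_coeffs_eq_zero_of_root hsq (α := 2 * k * t * ρ - b * ρ ^ 2)
        (β := b * ρ ^ 2 - k) (by push_cast; linear_combination h + b * ρ ^ 2 * hsq)
      obtain ⟨h1, h2⟩ := this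
      have h3 : ρ * (2 * k * t - b * ρ) = 0 := by linear_combination h1
      have h4 : 2 * k * t = b * ρ := by
        rcases mul_eq_zero.1 h3 with h | h
        · exact absurd h hρ.ne'
        · linarith
      have h5 : b * k = 4 * t ^ 2 * k * k := by
        have : b * (b * ρ ^ 2) = b * k := by rw [sub_eq_zero.1 h2]
        nlinarith
      nlinarith
    · rcases mul_eq_zero.1 h with h | h
      · have h1 := real_coeffs_eq_zero_of_root hsq (α := 0)
          (β := -k - (b * ρ - t * k) * ρ) (by
            push_cast
            linear_combination h + ((t * k * ρ : ℂ) - b * ρ ^ 2 * (e + 1)) * hsq)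
        have h2 := h1.2
        have h3 : (2 * b * ρ - t * k) ^ 2 = k * (t ^ 2 * k - 4 * b) := by
          linear_combination (-4 * b) * h2
        have h4 : t ^ 2 * k - 4 * b < 0 := by
          have : 0 ≤ t ^ 2 * k := by positivity
          nlinarith
        nlinarith [sq_nonneg (2 * b * ρ - t * k), mul_pos hk (neg_pos.2 h4)]
      · have h1 := real_coeffs_eq_zero_of_root hsq (α := k * t * ρ + b * ρ ^ 2)
          (β := -k + (b * ρ - t * k) * ρ - b * ρ ^ 2) (by
            push_cast
            linear_combination h + (b * ρ ^ 2 * (e ^ 2 + e) - t * k * ρ * (e + 1) : ℂ) * hsq)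
        have h2 : 0 < k * t * ρ + b * ρ ^ 2 := by positivity
        linarith [h1.1]

/-- The recursion satisfied by the pair of conditional partition functions. -/
noncomputable def pottsStep (t a b : ℝ) (z : ℂ) (v : ℂ × ℂ) : ℂ × ℂ :=
  (z⁻¹ * (v.1 + a * v.2) ^ 2, (t * v.1 + b * v.2) ^ 2)

/-- The partition function of three joined rooted trees. -/
noncomputable def pottsTop (t a b k : ℝ) (z : ℂ) (v : ℂ × ℂ) : ℂ :=
  z⁻¹ * (v.1 + a * v.2) ^ 3 + k * (t * v.1 + b * v.2) ^ 3

/-- The orbit of the pair of conditional partition functions. -/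
noncomputable def pottsOrbit (t a b : ℝ) : ℕ → ℂ → ℂ × ℂ
  | 0, z => (z⁻¹, 1)
  | n + 1, z => pottsStep t a b z (pottsOrbit t a b n z)

theorem pottsStep_ne_zero {t a b : ℝ} (hd : t * a < b) {z : ℂ} (hz : z ≠ 0) {v : ℂ × ℂ}
    (hv : v ≠ 0) : pottsStep t a b z v ≠ 0 := by
  intro h
  have h1 := congrArg Prod.fst h
  have h2 := congrArg Prod.snd h
  simp only [pottsStep, Prod.fst_zero, Prod.snd_zero, mul_eq_zero, inv_eq_zero, hz, false_or,
    pow_eq_zero_iff (two_ne_zero)] at h1 h2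
  have hne : (b : ℂ) - t * a ≠ 0 := by
    have : b - t * a ≠ 0 := by linarith
    exact_mod_cast this
  refine hv (Prod.ext ?_ ?_)
  · have : ((b : ℂ) - t * a) * v.1 = 0 := by linear_combination b * h1 - a * h2
    exact (mul_eq_zero.1 this).resolve_left hne
  · have : ((b : ℂ) - t * a) * v.2 = 0 := by linear_combination h2 - t * h1
    exact (mul_eq_zero.1 this).resolve_left hne

/-- At a positive real point, `pottsTop` does not vanish at two consecutive points of an orbit. -/
theorem pottsTop_step_ne_zero {t a b k p : ℝ} (ht : 0 ≤ t) (hb : 0 < b) (hk : 0 < k)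
    (ha : a = k * t) (hbt : 4 * t ^ 2 * k < b) (hp : 0 < p) {v : ℂ × ℂ} (hv : v ≠ 0)
    (h : pottsTop t a b k p v = 0) : pottsTop t a b k p (pottsStep t a b p v) ≠ 0 := by
  intro h'
  have hpc : (p : ℂ) ≠ 0 := by exact_mod_cast hp.ne'
  have hkc : (k : ℂ) ≠ 0 := by exact_mod_cast hk.ne'
  have hd : t * a < b := by
    rw [ha]
    have : 0 ≤ t ^ 2 * k := by positivity
    nlinarith
  have hstep := pottsStep_ne_zero hd hpc hv
  obtain ⟨A, hA⟩ : ∃ A, A = v.1 + a * v.2 := ⟨_, rfl⟩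
  obtain ⟨B, hB⟩ : ∃ B, B = t * v.1 + b * v.2 := ⟨_, rfl⟩
  simp only [pottsTop, pottsStep, ← hA, ← hB] at h h' hstep
  have hB0 : B ≠ 0 := by
    rintro rfl
    have : A = 0 := by simpa [hpc] using h
    exact hstep (by simp [this])
  obtain ⟨u, rfl⟩ : ∃ u, A = u * B := ⟨A / B, by field_simp⟩
  have hu : u ^ 3 = -(k * p) := by
    have h1 : B ^ 3 * (u ^ 3 + k * p) = 0 := by
      field_simp at h
      linear_combination h
    have := (mul_eq_zero.1 h1).resolve_left (pow_ne_zero _ hB0)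
    linear_combination this
  have hu0 : u ≠ 0 := by
    rintro rfl
    have : (k : ℂ) * p = 0 := by linear_combination hu
    exact (mul_ne_zero hkc hpc) this
  have hkp : 0 < k * p := mul_pos hk hp
  obtain ⟨ρ, hρ, hρ3⟩ : ∃ ρ : ℝ, 0 < ρ ∧ ρ ^ 3 = k * p := by
    refine ⟨(k * p) ^ ((1 : ℝ) / 3), by positivity, ?_⟩
    rw [← Real.rpow_natCast, ← Real.rpow_mul hkp.le]
    norm_num
  refine cube_ne_cube_of_cube_eq_neg hρ hb hk ht hbt (u := u) ?_ ?_
  · rw [hu]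
    exact_mod_cast congrArg (fun r : ℝ => -(r : ℂ)) hρ3.symm
  · have hpu : (p : ℂ)⁻¹ = -k / u ^ 3 := by
      rw [hu]
      field_simp
    rw [hpu, ha] at h'
    push_cast at h'
    field_simp at h'
    have h2 : ((k : ℂ) * B ^ 6) * (((k : ℂ) * (t * u - 1)) ^ 3 - (u * (b * u - t * k)) ^ 3) = 0 := by
      linear_combination -h'
    exact sub_eq_zero.1 ((mul_eq_zero.1 h2).resolve_left
      (mul_ne_zero hkc (pow_ne_zero _ hB0)))

/-- A function on `ℂ × ℂ × ℂ` that is positive at the points of the unit sphere over `p` is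
uniformly positive on the unit spheres over nearby points. -/
theorem exists_pos_le_on_sphere {m : ℂ → ℂ × ℂ → ℝ} {p : ℂ}
    (hm : ∀ v, ContinuousAt (fun x : ℂ × ℂ × ℂ => m x.1 x.2) (p, v))
    (hpos : ∀ v ∈ Metric.sphere (0 : ℂ × ℂ) 1, 0 < m p v) :
    ∃ c : ℝ, 0 < c ∧ ∀ᶠ z in nhds p, ∀ v ∈ Metric.sphere (0 : ℂ × ℂ) 1, c ≤ m z v := by
  have hK : IsCompact (Metric.sphere (0 : ℂ × ℂ) 1) := isCompact_sphere _ _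
  have hne : (Metric.sphere (0 : ℂ × ℂ) 1).Nonempty := ⟨(1, 0), by simp [Prod.norm_def]⟩
  have hc : ContinuousOn (m p) (Metric.sphere (0 : ℂ × ℂ) 1) := fun v _ =>
    (ContinuousAt.comp (f := fun v : ℂ × ℂ => (p, v)) (hm v)
      (by fun_prop)).continuousWithinAt
  obtain ⟨v₀, hv₀, hmin⟩ := hK.exists_isMinOn hne hc
  refine ⟨m p v₀ / 2, half_pos (hpos _ hv₀), ?_⟩
  refine hK.eventually_forall_of_forall_eventually fun v hv => ?_
  have : m p v₀ / 2 < m p v := by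
    have := hmin hv
    have h2 := hpos _ hv₀
    simp only [Set.mem_ofPred_eq] at this
    linarith
  filter_upwards [(hm v).eventually (lt_mem_nhds this)] with x hx using hx.le

theorem exists_le_on_sphere {m : ℂ → ℂ × ℂ → ℝ} {p : ℂ}
    (hm : ∀ v, ContinuousAt (fun x : ℂ × ℂ × ℂ => m x.1 x.2) (p, v)) :
    ∃ C : ℝ, 0 < C ∧ ∀ᶠ z in nhds p, ∀ v ∈ Metric.sphere (0 : ℂ × ℂ) 1, m z v ≤ C := by
  obtain ⟨c, hc, h⟩ := exists_pos_le_on_sphere (m := fun z v => (1 + |m z v|)⁻¹) (p := p)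
    (fun v => ((hm v).abs.const_add 1).inv₀ (by positivity)) (fun v _ => by positivity)
  refine ⟨c⁻¹, by positivity, h.mono fun z hz v hv => ?_⟩
  have h1 := hz v hv
  rw [le_inv_comm₀ hc (by positivity)] at h1
  linarith [le_abs_self (m z v)]

theorem pottsStep_smul (t a b : ℝ) (z : ℂ) (r : ℂ) (v : ℂ × ℂ) :
    pottsStep t a b z (r • v) = r ^ 2 • pottsStep t a b z v := by
  ext <;> simp [pottsStep] <;> ring

theorem pottsTop_smul (t a b k : ℝ) (z : ℂ) (r : ℂ) (v : ℂ × ℂ) :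
    pottsTop t a b k z (r • v) = r ^ 3 * pottsTop t a b k z v := by
  simp [pottsTop]
  ring

theorem continuousAt_pottsStep (t a b : ℝ) {p : ℂ} (hp : p ≠ 0) (v : ℂ × ℂ) :
    ContinuousAt (fun x : ℂ × ℂ × ℂ => pottsStep t a b x.1 x.2) (p, v) := by
  unfold pottsStep
  have : ContinuousAt (fun x : ℂ × ℂ × ℂ => x.1⁻¹) (p, v) := continuousAt_fst.inv₀ hp
  fun_prop

theorem continuousAt_pottsTop (t a b k : ℝ) {p : ℂ} (hp : p ≠ 0) (v : ℂ × ℂ) :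
    ContinuousAt (fun x : ℂ × ℂ × ℂ => pottsTop t a b k x.1 x.2) (p, v) := by
  unfold pottsTop
  have : ContinuousAt (fun x : ℂ × ℂ × ℂ => x.1⁻¹) (p, v) := continuousAt_fst.inv₀ hp
  fun_prop

/-- Logarithmic form of the homogeneity bounds for `pottsStep` and `pottsTop` near a positive real
point. -/
theorem exists_potts_log_bounds {t a b k p : ℝ} (ht : 0 ≤ t) (hb : 0 < b) (hk : 0 < k)
    (ha : a = k * t) (hbt : 4 * t ^ 2 * k < b) (hp : 0 < p) :
    ∃ K : ℝ, 0 ≤ K ∧ ∀ᶠ z in nhds (p : ℂ), ∀ v : ℂ × ℂ, v ≠ 0 →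
      |Real.log ‖pottsStep t a b z v‖ - 2 * Real.log ‖v‖| ≤ K ∧
      (pottsTop t a b k z v ≠ 0 →
        Real.log ‖pottsTop t a b k z v‖ ≤ 3 * Real.log ‖v‖ + K) ∧
      (pottsTop t a b k z v ≠ 0 → pottsTop t a b k z (pottsStep t a b z v) ≠ 0 →
        3 * Real.log ‖v‖ - K ≤ Real.log ‖pottsTop t a b k z v‖ ∨
        6 * Real.log ‖v‖ - K ≤ Real.log ‖pottsTop t a b k z (pottsStep t a b z v)‖) := by
  have hpc : (p : ℂ) ≠ 0 := by exact_mod_cast hp.ne'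
  have hd : t * a < b := by
    rw [ha]
    have : 0 ≤ t ^ 2 * k := by positivity
    nlinarith
  have hsph : ∀ v ∈ Metric.sphere (0 : ℂ × ℂ) 1, v ≠ 0 := by
    rintro v hv rfl
    simp at hv
  have cS := continuousAt_pottsStep t a b hpc
  have cT := continuousAt_pottsTop t a b k hpc
  have cTS : ∀ v, ContinuousAt
      (fun x : ℂ × ℂ × ℂ => pottsTop t a b k x.1 (pottsStep t a b x.1 x.2)) ((p : ℂ), v) := by
    intro v
    exact ContinuousAt.comp (f := fun x : ℂ × ℂ × ℂ => (x.1, pottsStep t a b x.1 x.2))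
      (cT (pottsStep t a b p v)) (continuousAt_fst.prodMk (cS v))
  obtain ⟨c₁, hc₁, h₁⟩ := exists_pos_le_on_sphere
    (m := fun z v => ‖pottsStep t a b z v‖) (p := (p : ℂ)) (fun v => (cS v).norm)
    (fun v hv => norm_pos_iff.2 (pottsStep_ne_zero hd hpc (hsph v hv)))
  obtain ⟨C₁, hC₁, H₁⟩ := exists_le_on_sphere
    (m := fun z v => ‖pottsStep t a b z v‖) (p := (p : ℂ)) (fun v => (cS v).norm)
  obtain ⟨C₂, hC₂, H₂⟩ := exists_le_on_sphere
    (m := fun z v => ‖pottsTop t a b k z v‖) (p := (p : ℂ)) (fun v => (cT v).norm)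
  obtain ⟨c₃, hc₃, h₃⟩ := exists_pos_le_on_sphere
    (m := fun z v => max ‖pottsTop t a b k z v‖ ‖pottsTop t a b k z (pottsStep t a b z v)‖)
    (p := (p : ℂ)) (fun v => (cT v).norm.max (cTS v).norm)
    (fun v hv => by
      by_cases h : pottsTop t a b k p v = 0
      · exact lt_max_of_lt_right (norm_pos_iff.2
          (pottsTop_step_ne_zero ht hb hk ha hbt hp (hsph v hv) h))
      · exact lt_max_of_lt_left (norm_pos_iff.2 h))
  refine ⟨|Real.log c₁| + |Real.log C₁| + |Real.log C₂| + |Real.log c₃|, by positivity, ?_⟩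
  filter_upwards [h₁, H₁, H₂, h₃, isOpen_ne.mem_nhds hpc] with z h₁ H₁ H₂ h₃ hz v hv
  have hvn : 0 < ‖v‖ := norm_pos_iff.2 hv
  obtain ⟨w, hw, hvw⟩ : ∃ w ∈ Metric.sphere (0 : ℂ × ℂ) 1, v = ((‖v‖ : ℝ) : ℂ) • w := by
    have hne : ((‖v‖ : ℝ) : ℂ) ≠ 0 := by exact_mod_cast hvn.ne'
    refine ⟨((‖v‖ : ℝ) : ℂ)⁻¹ • v, ?_, ?_⟩
    · rw [mem_sphere_zero_iff_norm, norm_smul, norm_inv, Complex.norm_real, norm_norm,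
        inv_mul_cancel₀ hvn.ne']
    · rw [smul_smul, mul_inv_cancel₀ hne, one_smul]
  have e1 : ‖pottsStep t a b z v‖ = ‖v‖ ^ 2 * ‖pottsStep t a b z w‖ := by
    conv_lhs => rw [hvw, pottsStep_smul, norm_smul, norm_pow, Complex.norm_real, norm_norm]
  have e2 : ‖pottsTop t a b k z v‖ = ‖v‖ ^ 3 * ‖pottsTop t a b k z w‖ := by
    conv_lhs => rw [hvw, pottsTop_smul, norm_mul, norm_pow, Complex.norm_real, norm_norm]
  have e3 : ‖pottsTop t a b k z (pottsStep t a b z v)‖ =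
      ‖v‖ ^ 6 * ‖pottsTop t a b k z (pottsStep t a b z w)‖ := by
    conv_lhs => rw [hvw, pottsStep_smul, pottsTop_smul, norm_mul, norm_pow, norm_pow,
      Complex.norm_real, norm_norm]
    ring
  have logle : ∀ {x y : ℝ}, 0 < x → x ≤ y → Real.log x ≤ Real.log y := Real.log_le_log
  have ab1 := abs_le.1 (le_refl |Real.log c₁|)
  have ab2 := abs_le.1 (le_refl |Real.log C₁|)
  have ab3 := abs_le.1 (le_refl |Real.log C₂|)
  have ab4 := abs_le.1 (le_refl |Real.log c₃|)
  have nn1 := abs_nonneg (Real.log c₁)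
  have nn2 := abs_nonneg (Real.log C₁)
  have nn3 := abs_nonneg (Real.log C₂)
  have nn4 := abs_nonneg (Real.log c₃)
  refine ⟨?_, fun hT => ?_, fun hT hTS => ?_⟩
  · have hpos : 0 < ‖pottsStep t a b z w‖ :=
      norm_pos_iff.2 (pottsStep_ne_zero hd hz (hsph w hw))
    rw [e1, Real.log_mul (by positivity) hpos.ne', Real.log_pow]
    have l1 := logle hc₁ (h₁ w hw)
    have l2 := logle hpos (H₁ w hw)
    rw [abs_le]
    push_cast
    constructor <;> linarith
  · have hpos : 0 < ‖pottsTop t a b k z w‖ := by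
      have := norm_pos_iff.2 hT
      rw [e2] at this
      exact (pos_iff_pos_of_mul_pos this).1 (by positivity)
    rw [e2, Real.log_mul (by positivity) hpos.ne', Real.log_pow]
    have l2 := logle hpos (H₂ w hw)
    push_cast
    linarith
  · rcases le_max_iff.1 (h₃ w hw) with h | h
    · left
      rw [e2, Real.log_mul (by positivity) (hc₃.trans_le h).ne', Real.log_pow]
      have := logle hc₃ h
      push_cast
      linarith
    · right
      rw [e3, Real.log_mul (by positivity) (hc₃.trans_le h).ne', Real.log_pow]
      have := logle hc₃ h
      push_cast
      linarith

/-- The orbit of `1` under the recursion for the ratio of conditional partition functions. -/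
noncomputable def ratioOrbit (t a b x : ℝ) : ℕ → ℝ
  | 0 => 1
  | n + 1 => (ratioOrbit t a b x n + a) ^ 2 / (x * (t * ratioOrbit t a b x n + b) ^ 2)

theorem ratioOrbit_succ (t a b x : ℝ) (n : ℕ) : ratioOrbit t a b x (n + 1) =
    (ratioOrbit t a b x n + a) ^ 2 / (x * (t * ratioOrbit t a b x n + b) ^ 2) := rfl

theorem ratioOrbit_pos {t a b x : ℝ} (ht : 0 ≤ t) (ha : 0 ≤ a) (hb : 0 < b) (hx : 0 < x) (n : ℕ) :
    0 < ratioOrbit t a b x n := by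
  induction n with
  | zero => exact one_pos
  | succ n ih =>
    rw [ratioOrbit_succ]
    positivity

theorem ratioStep_mono {t a b x v w : ℝ} (ht : 0 ≤ t) (ha : 0 ≤ a) (hb : 0 < b) (hd : t * a ≤ b)
    (hx : 0 < x) (hv : 0 ≤ v) (hvw : v ≤ w) :
    (v + a) ^ 2 / (x * (t * v + b) ^ 2) ≤ (w + a) ^ 2 / (x * (t * w + b) ^ 2) := by
  have hw : 0 ≤ w := hv.trans hvw
  have e : ∀ u, (u + a) ^ 2 / (x * (t * u + b) ^ 2) = ((u + a) / (t * u + b)) ^ 2 / x := by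
    intro u
    rw [div_pow, div_div, mul_comm x]
  rw [e, e]
  have : (v + a) / (t * v + b) ≤ (w + a) / (t * w + b) := by
    rw [div_le_div_iff₀ (by positivity) (by positivity)]
    nlinarith [mul_nonneg (sub_nonneg.2 hvw) (sub_nonneg.2 hd)]
  have h0 : 0 ≤ (v + a) / (t * v + b) := by positivity
  gcongr

theorem ratioOrbit_one {t a b x : ℝ} (ht : 0 ≤ t) (hb : 0 < b) (hab : 1 + a = t + b) :
    ratioOrbit t a b x 1 = 1 / x := by
  have h : (t + b) ≠ 0 := by positivity
  simp only [ratioOrbit, mul_one, hab]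
  field_simp

theorem ratioOrbit_monotone {t a b x : ℝ} (ht : 0 ≤ t) (ha : 0 ≤ a) (hb : 0 < b)
    (hab : 1 + a = t + b) (hd : t * a ≤ b) (hx : 0 < x) (hx1 : x ≤ 1) :
    Monotone (ratioOrbit t a b x) := by
  refine monotone_nat_of_le_succ fun n => ?_
  induction n with
  | zero =>
    rw [ratioOrbit_one ht hb hab, le_div_iff₀ hx]
    simpa [ratioOrbit] using hx1
  | succ n ih =>
    exact ratioStep_mono ht ha hb hd hx (ratioOrbit_pos ht ha hb hx n).le ih

theorem ratioOrbit_antitone {t a b x : ℝ} (ht : 0 ≤ t) (ha : 0 ≤ a) (hb : 0 < b)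
    (hab : 1 + a = t + b) (hd : t * a ≤ b) (hx : 0 < x) (hx1 : 1 ≤ x) :
    Antitone (ratioOrbit t a b x) := by
  refine antitone_nat_of_succ_le fun n => ?_
  induction n with
  | zero =>
    rw [ratioOrbit_one ht hb hab, div_le_iff₀ hx]
    simpa [ratioOrbit] using hx1
  | succ n ih =>
    exact ratioStep_mono ht ha hb hd hx (ratioOrbit_pos ht ha hb hx (n + 1)).le ih

/-- A limit of the ratio orbit along an ultrafilter is an honest limit. -/
theorem tendsto_ratioOrbit_of_hyperfilter {t a b x l : ℝ} (ht : 0 ≤ t) (ha : 0 ≤ a) (hb : 0 < b)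
    (hab : 1 + a = t + b) (hd : t * a ≤ b) (hx : 0 < x)
    (h : Filter.Tendsto (fun n => ratioOrbit t a b x (n + 1)) (Filter.hyperfilter ℕ) (nhds l)) :
    Filter.Tendsto (ratioOrbit t a b x) Filter.atTop (nhds l) := by
  have shift := Filter.tendsto_add_atTop_nat 1
  have hU : ((Filter.hyperfilter ℕ : Ultrafilter ℕ) : Filter ℕ) ≤ Filter.atTop :=
    Nat.hyperfilter_le_atTop
  have conclude : (∃ l', Filter.Tendsto (ratioOrbit t a b x) Filter.atTop (nhds l')) →
      Filter.Tendsto (ratioOrbit t a b x) Filter.atTop (nhds l) := by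
    rintro ⟨l', hl'⟩
    rwa [tendsto_nhds_unique h ((hl'.comp shift).mono_left hU)]
  apply conclude
  rcases le_total x 1 with hx1 | hx1
  · rcases tendsto_atTop_of_monotone (ratioOrbit_monotone ht ha hb hab hd hx hx1) with h' | h'
    · exact absurd h (not_tendsto_nhds_of_tendsto_atTop ((h'.comp shift).mono_left hU) l)
    · exact h'
  · rcases tendsto_atTop_of_antitone (ratioOrbit_antitone ht ha hb hab hd hx hx1) with h' | h'
    · exact absurd h (not_tendsto_nhds_of_tendsto_atBot ((h'.comp shift).mono_left hU) l)
    · exact h'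

theorem pottsOrbit_ofReal {t a b x : ℝ} (ht : 0 ≤ t) (ha : 0 ≤ a) (hb : 0 < b)
    (hab : 1 + a = t + b) (hx : 0 < x) (n : ℕ) : ∃ y : ℝ, 0 < y ∧
      pottsOrbit t a b n x = (((ratioOrbit t a b x (n + 1) * y : ℝ) : ℂ), (y : ℂ)) := by
  induction n with
  | zero =>
    refine ⟨1, one_pos, ?_⟩
    rw [ratioOrbit_one ht hb hab]
    simp [pottsOrbit]
  | succ n ih =>
    obtain ⟨y, hy, h⟩ := ih
    have hs := ratioOrbit_pos ht ha hb hx (n + 1)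
    refine ⟨(t * (ratioOrbit t a b x (n + 1) * y) + b * y) ^ 2, by positivity, ?_⟩
    rw [ratioOrbit_succ, pottsOrbit, h, pottsStep]
    refine Prod.ext ?_ ?_
    · have : x⁻¹ * (ratioOrbit t a b x (n + 1) * y + a * y) ^ 2 =
          (ratioOrbit t a b x (n + 1) + a) ^ 2 / (x * (t * ratioOrbit t a b x (n + 1) + b) ^ 2) *
          (t * (ratioOrbit t a b x (n + 1) * y) + b * y) ^ 2 := by
        have : t * ratioOrbit t a b x (n + 1) + b ≠ 0 := by positivity
        field_simp
      rw [← this]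
      push_cast
      ring
    · push_cast
      ring

theorem pottsOrbit_differentiableAt (t a b : ℝ) {z : ℂ} (hz : z ≠ 0) (n : ℕ) :
    DifferentiableAt ℂ (fun z => (pottsOrbit t a b n z).1) z ∧
    DifferentiableAt ℂ (fun z => (pottsOrbit t a b n z).2) z := by
  induction n with
  | zero => exact ⟨differentiableAt_inv hz, differentiableAt_const _⟩
  | succ n ih =>
    obtain ⟨h1, h2⟩ := ih
    have := differentiableAt_inv (𝕜 := ℂ) hz
    simp only [pottsOrbit, pottsStep]
    constructor <;> fun_prop

theorem pottsTop_orbit_differentiableAt (t a b k : ℝ) {z : ℂ} (hz : z ≠ 0) (n : ℕ) :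
    DifferentiableAt ℂ (fun z => pottsTop t a b k z (pottsOrbit t a b n z)) z := by
  obtain ⟨h1, h2⟩ := pottsOrbit_differentiableAt t a b hz n
  have := differentiableAt_inv (𝕜 := ℂ) hz
  simp only [pottsTop]
  fun_prop

theorem pottsOrbit_ne_zero {t a b : ℝ} (hd : t * a < b) {z : ℂ} (hz : z ≠ 0) (n : ℕ) :
    pottsOrbit t a b n z ≠ 0 := by
  induction n with
  | zero => simp [pottsOrbit]
  | succ n ih => exact pottsStep_ne_zero hd hz ih

theorem pottsTop_ofReal (t a b k x v w : ℝ) : pottsTop t a b k x (v, w) =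
    ((x⁻¹ * (v + a * w) ^ 3 + k * (t * v + b * w) ^ 3 : ℝ) : ℂ) := by
  simp [pottsTop]

theorem pottsTop_log_lower {t a b k x X v w : ℝ} (ht : 0 ≤ t) (ha : 0 ≤ a) (hb : 0 < b)
    (hk : 0 < k) (hx : 0 < x) (hxX : x ≤ X) (hv : 0 < v) (hw : 0 < w) :
    3 * Real.log ‖((v : ℂ), (w : ℂ))‖ - |Real.log (min X⁻¹ (k * b ^ 3))| ≤
      Real.log ‖pottsTop t a b k x (v, w)‖ := by
  have hX : 0 < X := hx.trans_le hxX
  have hc : 0 < min X⁻¹ (k * b ^ 3) := lt_min (by positivity) (by positivity)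
  have hn : ‖((v : ℂ), (w : ℂ))‖ = max v w := by
    rw [Prod.norm_def, Complex.norm_real, Complex.norm_real, Real.norm_of_nonneg hv.le,
      Real.norm_of_nonneg hw.le]
  have hm : 0 < max v w := lt_max_of_lt_left hv
  have h1 : min X⁻¹ (k * b ^ 3) * v ^ 3 ≤ x⁻¹ * (v + a * w) ^ 3 := by
    have : v ≤ v + a * w := by nlinarith [mul_nonneg ha hw.le]
    have h2 : X⁻¹ ≤ x⁻¹ := by gcongr
    have h3 := (min_le_left X⁻¹ (k * b ^ 3)).trans h2
    gcongr
  have h2 : min X⁻¹ (k * b ^ 3) * w ^ 3 ≤ k * (t * v + b * w) ^ 3 := by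
    have : b * w ≤ t * v + b * w := by nlinarith [mul_nonneg ht hv.le]
    calc min X⁻¹ (k * b ^ 3) * w ^ 3 ≤ k * b ^ 3 * w ^ 3 := by gcongr; exact min_le_right _ _
      _ = k * (b * w) ^ 3 := by ring
      _ ≤ _ := by gcongr
  have h3 : 0 ≤ x⁻¹ * (v + a * w) ^ 3 := by positivity
  have h4 : 0 ≤ k * (t * v + b * w) ^ 3 := by positivity
  have key : min X⁻¹ (k * b ^ 3) * (max v w) ^ 3 ≤
      x⁻¹ * (v + a * w) ^ 3 + k * (t * v + b * w) ^ 3 := by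
    rcases le_total v w with h | h
    · rw [max_eq_right h]
      linarith
    · rw [max_eq_left h]
      linarith
  rw [hn, pottsTop_ofReal, Complex.norm_real, Real.norm_of_nonneg (by linarith)]
  have := Real.log_le_log (by positivity) key
  rw [Real.log_mul hc.ne' (by positivity), Real.log_pow] at this
  push_cast at this
  linarith [neg_abs_le (Real.log (min X⁻¹ (k * b ^ 3)))]

/-- If no zeros accumulate at `p > 0`, then the limit of the ratio orbit depends differentiably on
the parameter near `p`. -/
theorem differentiableAt_limit_of_zero_free {t a b k p M : ℝ} (ht : 0 ≤ t) (hb : 0 < b)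
    (hk : 0 < k) (ha : a = k * t) (hab : 1 + a = t + b) (hbt : 4 * t ^ 2 * k < b) (hp : 0 < p)
    (hM : ∀ n, ratioOrbit t a b p n ≤ M)
    (hfree : ∀ᶠ z in nhds (p : ℂ), ∀ n, pottsTop t a b k z (pottsOrbit t a b n z) ≠ 0) :
    ∃ ω : ℝ → ℝ, DifferentiableAt ℝ ω p ∧
      ∀ᶠ x in nhds p, Filter.Tendsto (ratioOrbit t a b x) Filter.atTop (nhds (ω x)) := by
  have hpc : (p : ℂ) ≠ 0 := by exact_mod_cast hp.ne'
  have ha0 : 0 ≤ a := by rw [ha]; positivity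
  have hd : t * a < b := by
    rw [ha]
    have : 0 ≤ t ^ 2 * k := by positivity
    nlinarith
  obtain ⟨K, hK, hbounds⟩ := exists_potts_log_bounds ht hb hk ha hbt hp
  have hcont : ContinuousAt (fun z : ℂ => |Real.log ‖pottsOrbit t a b 0 z‖|) (p : ℂ) := by
    have h1 : ContinuousAt (fun z : ℂ => pottsOrbit t a b 0 z) (p : ℂ) :=
      (continuousAt_inv₀ hpc).prodMk continuousAt_const
    exact (h1.norm.log (norm_ne_zero_iff.2 (pottsOrbit_ne_zero hd hpc 0))).abs
  obtain ⟨K₀, hK₀⟩ : ∃ K₀, |Real.log ‖pottsOrbit t a b 0 (p : ℂ)‖| < K₀ := exists_gt _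
  have hre : ∀ᶠ z : ℂ in nhds (p : ℂ), 0 < z.re ∧ z.re < 2 * p := by
    refine Complex.continuous_re.continuousAt.eventually (Ioo_mem_nhds ?_ ?_)
    · simpa using hp
    · simp only [Complex.ofReal_re]
      linarith
  obtain ⟨R, hR, hball⟩ := Metric.eventually_nhds_iff_ball.1
    (hfree.and (hbounds.and ((hcont.eventually (gt_mem_nhds hK₀)).and hre)))
  set K₁ := |Real.log (min (2 * p)⁻¹ (k * b ^ 3))| with hK₁
  have hK₁0 : 0 ≤ K₁ := abs_nonneg _
  have hK₀0 : 0 ≤ K₀ := (abs_nonneg _).trans hK₀.le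
  have hne : ∀ z ∈ Metric.ball (p : ℂ) R, z ≠ 0 := by
    rintro z hz rfl
    have := (hball 0 hz).2.2.2.1
    simp at this
  have hxpos : ∀ x : ℝ, (x : ℂ) ∈ Metric.ball (p : ℂ) R → 0 < x ∧ x < 2 * p := fun x hx => by
    simpa using (hball x hx).2.2.2
  have H : ZeroFreeGrowth p R (K + K₀ + K₁) (pottsOrbit t a b)
      (fun n z => pottsTop t a b k z (pottsOrbit t a b n z)) :=
    { radius_pos := hR
      const_nonneg := by linarith
      fst_holo := fun n z hz =>
        (pottsOrbit_differentiableAt t a b (hne z hz) n).1.differentiableWithinAt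
      snd_holo := fun n z hz =>
        (pottsOrbit_differentiableAt t a b (hne z hz) n).2.differentiableWithinAt
      holo := fun n z hz =>
        (pottsTop_orbit_differentiableAt t a b k (hne z hz) n).differentiableWithinAt
      ne_zero := fun n z hz => (hball z hz).1 n
      coord_ne_zero := fun n z hz => pottsOrbit_ne_zero hd (hne z hz) n
      initial := fun z hz => by linarith [(hball z hz).2.2.1]
      step := fun n z hz => by
        have := ((hball z hz).2.1 _ (pottsOrbit_ne_zero hd (hne z hz) n)).1
        rw [pottsOrbit]
        linarith
      upper := fun n z hz => by
        have := ((hball z hz).2.1 _ (pottsOrbit_ne_zero hd (hne z hz) n)).2.1 ((hball z hz).1 n)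
        linarith
      lower_or := fun n z hz => by
        refine (((hball z hz).2.1 _ (pottsOrbit_ne_zero hd (hne z hz) n)).2.2
          ((hball z hz).1 n) ((hball z hz).1 (n + 1))).imp (fun h => ?_) (fun h => ?_)
        · linarith
        · rw [pottsOrbit]
          linarith
      real_pos := fun n x hx => by
        obtain ⟨hx0, -⟩ := hxpos x hx
        obtain ⟨y, hy, e⟩ := pottsOrbit_ofReal ht ha0 hb hab hx0 n
        have := ratioOrbit_pos ht ha0 hb hx0 (n + 1)
        refine ⟨x⁻¹ * (ratioOrbit t a b x (n + 1) * y + a * y) ^ 3 +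
          k * (t * (ratioOrbit t a b x (n + 1) * y) + b * y) ^ 3, by positivity, ?_⟩
        rw [e, pottsTop_ofReal]
      real_lower := fun n x hx => by
        obtain ⟨hx0, hx2⟩ := hxpos x hx
        obtain ⟨y, hy, e⟩ := pottsOrbit_ofReal ht ha0 hb hab hx0 n
        have := ratioOrbit_pos ht ha0 hb hx0 (n + 1)
        have := pottsTop_log_lower (t := t) (a := a) (b := b) (k := k) ht ha0 hb hk hx0 hx2.le
          (mul_pos this hy) hy
        simp only [e]
        linarith }
  obtain ⟨A, B, s, hA, hB, hlim⟩ := H.exists_limit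
  have hpR : (p : ℂ) ∈ Metric.ball (p : ℂ) (R / 2) := Metric.mem_ball_self (by linarith)
  have hsub : Metric.ball (p : ℂ) (R / 2) ⊆ Metric.ball (p : ℂ) R :=
    Metric.ball_subset_ball (by linarith)
  have hBp : B p ≠ 0 := by
    obtain ⟨hor, hl1, hl2⟩ := hlim p hpR
    have hle : ‖A p‖ ≤ M * ‖B p‖ := by
      refine le_of_tendsto_of_tendsto hl1.norm (hl2.norm.const_mul M)
        (Filter.Eventually.of_forall fun n => ?_)
      obtain ⟨y, hy, e⟩ := pottsOrbit_ofReal ht ha0 hb hab hp n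
      have hs := ratioOrbit_pos ht ha0 hb hp (n + 1)
      simp only [e, norm_mul, Complex.norm_real, Complex.ofReal_mul, Real.norm_eq_abs,
        abs_of_pos hs]
      have := mul_le_mul_of_nonneg_right (hM (n + 1))
        (mul_nonneg (norm_nonneg (s n p)) (abs_nonneg y))
      linarith
    intro h0
    rw [h0, norm_zero, mul_zero, norm_le_zero_iff] at hle
    rcases hor with h | h
    · exact h hle
    · exact h h0
  have hmem : Metric.ball (p : ℂ) (R / 2) ∈ nhds (p : ℂ) := Metric.isOpen_ball.mem_nhds hpR
  have hW : DifferentiableAt ℂ (fun z => A z / B z) (p : ℂ) :=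
    (hA.differentiableAt hmem).div (hB.differentiableAt hmem) hBp
  refine ⟨fun x => (A x / B x).re, hW.hasDerivAt.real_of_complex.differentiableAt, ?_⟩
  have hBev : ∀ᶠ z in nhds (p : ℂ), B z ≠ 0 :=
    (hB.differentiableAt hmem).continuousAt.eventually_ne hBp
  filter_upwards [Complex.continuous_ofReal.continuousAt.eventually (hBev.and hmem)] with x hx
  obtain ⟨hBx, hxR⟩ := hx
  obtain ⟨hx0, -⟩ := hxpos x (hsub hxR)
  obtain ⟨-, hl1, hl2⟩ := hlim x hxR
  refine tendsto_ratioOrbit_of_hyperfilter ht ha0 hb hab hd.le hx0 ?_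
  refine ((Complex.continuous_re.tendsto _).comp (hl1.div hl2 hBx)).congr' ?_
  filter_upwards [hl2.eventually_ne hBx] with n hn
  obtain ⟨y, hy, e⟩ := pottsOrbit_ofReal ht ha0 hb hab hx0 n
  simp only [e] at hn
  have hsn : s n x ≠ 0 := left_ne_zero_of_mul hn
  have hyn : (y : ℂ) ≠ 0 := right_ne_zero_of_mul hn
  have : s n x * ((ratioOrbit t a b x (n + 1) * y : ℝ) : ℂ) / (s n x * (y : ℂ)) =
      ((ratioOrbit t a b x (n + 1) : ℝ) : ℂ) := by
    push_cast
    field_simp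
  change (s n x * (pottsOrbit t a b n x).1 / (s n x * (pottsOrbit t a b n x).2)).re = _
  rw [e]
  change (s n x * ((ratioOrbit t a b x (n + 1) * y : ℝ) : ℂ) / (s n x * (y : ℂ))).re = _
  rw [this, Complex.ofReal_re]

theorem pottsTop_orbit_ne_zero_of_pos {t a b k x : ℝ} (ht : 0 ≤ t) (ha : 0 ≤ a) (hb : 0 < b)
    (hk : 0 < k) (hab : 1 + a = t + b) (hx : 0 < x) (n : ℕ) :
    pottsTop t a b k x (pottsOrbit t a b n x) ≠ 0 := by
  obtain ⟨y, hy, e⟩ := pottsOrbit_ofReal ht ha hb hab hx n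
  have := ratioOrbit_pos ht ha hb hx (n + 1)
  rw [e, pottsTop_ofReal]
  have : 0 < x⁻¹ * (ratioOrbit t a b x (n + 1) * y + a * y) ^ 3 +
      k * (t * (ratioOrbit t a b x (n + 1) * y) + b * y) ^ 3 := by positivity
  exact_mod_cast ne_of_gt this

/-- Finitely many partition functions never matter for the accumulation of zeros at a positive
real point. -/
theorem eventually_forall_ne_zero_of_eventually_ge {t a b k p : ℝ} (ht : 0 ≤ t) (ha : 0 ≤ a)
    (hb : 0 < b) (hk : 0 < k) (hab : 1 + a = t + b) (hp : 0 < p) (N : ℕ)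
    (h : ∀ᶠ z in nhds (p : ℂ), ∀ n ≥ N, pottsTop t a b k z (pottsOrbit t a b n z) ≠ 0) :
    ∀ᶠ z in nhds (p : ℂ), ∀ n, pottsTop t a b k z (pottsOrbit t a b n z) ≠ 0 := by
  have hpc : (p : ℂ) ≠ 0 := by exact_mod_cast hp.ne'
  have h1 : ∀ᶠ z in nhds (p : ℂ), ∀ n ∈ Finset.range N,
      pottsTop t a b k z (pottsOrbit t a b n z) ≠ 0 := by
    rw [Filter.eventually_all_finset]
    intro n _
    exact (pottsTop_orbit_differentiableAt t a b k hpc n).continuousAt.eventually_ne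
      (pottsTop_orbit_ne_zero_of_pos ht ha hb hk hab hp n)
  filter_upwards [h, h1] with z hz hz1 n
  rcases lt_or_ge n N with hn | hn
  · exact hz1 n (Finset.mem_range.2 hn)
  · exact hz n hn

theorem fixedPoint_of_tendsto_ratioOrbit {t a b x w : ℝ} (ht : 0 ≤ t) (ha : 0 ≤ a) (hb : 0 < b)
    (hx : 0 < x) (h : Filter.Tendsto (ratioOrbit t a b x) Filter.atTop (nhds w)) :
    0 ≤ w ∧ x * w * (t * w + b) ^ 2 = (w + a) ^ 2 := by
  have hw : 0 ≤ w := ge_of_tendsto' h fun n => (ratioOrbit_pos ht ha hb hx n).le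
  refine ⟨hw, ?_⟩
  have hne : x * (t * w + b) ^ 2 ≠ 0 := by positivity
  have h1 : Filter.Tendsto (fun n => ratioOrbit t a b x (n + 1)) Filter.atTop
      (nhds ((w + a) ^ 2 / (x * (t * w + b) ^ 2))) :=
    ((h.add_const a).pow 2).div ((((h.const_mul t).add_const b).pow 2).const_mul x) hne
  have := tendsto_nhds_unique (h.comp (Filter.tendsto_add_atTop_nat 1)) h1
  rw [eq_div_iff hne] at this
  linear_combination this

/-- If the ratio orbit converges to an attracting fixed point, then no zeros accumulate. -/
theorem eventually_forall_ne_zero_of_attracting {t a b k p w : ℝ} (ht : 0 ≤ t) (ha : 0 ≤ a)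
    (hb : 0 < b) (hk : 0 < k) (hab : 1 + a = t + b) (hd : t * a ≤ b) (hp : 0 < p)
    (hw : Filter.Tendsto (ratioOrbit t a b p) Filter.atTop (nhds w))
    (hslope : 2 * (w + a) * (b - t * a) < p * (t * w + b) ^ 3) :
    ∀ᶠ z in nhds (p : ℂ), ∀ n, pottsTop t a b k z (pottsOrbit t a b n z) ≠ 0 := by
  have hpc : (p : ℂ) ≠ 0 := by exact_mod_cast hp.ne'
  obtain ⟨hw0, hfix⟩ := fixedPoint_of_tendsto_ratioOrbit ht ha hb hp hw
  have hden : 0 < t * w + b := by positivity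
  have hdenc : (t : ℂ) * w + b ≠ 0 := by exact_mod_cast hden.ne'
  set f : ℂ → ℂ → ℂ := fun z u => (u + a) ^ 2 / (z * (t * u + b) ^ 2) with hf
  set g : ℂ × ℂ → ℂ := fun y => (b - t * a) * ((y.2 + a) * (t * w + b) + (w + a) * (t * y.2 + b)) /
    (y.1 * (t * y.2 + b) ^ 2 * (t * w + b) ^ 2) with hg
  have hdiff : ∀ z u : ℂ, z ≠ 0 → t * u + b ≠ 0 → f z u - f z w = g (z, u) * (u - w) := by
    intro z u hz hu
    simp only [hf, hg]
    rw [div_sub_div _ _ (by positivity) (by positivity), div_mul_eq_mul_div,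
      div_eq_div_iff (by positivity) (by positivity)]
    ring
  have hcon : ContinuousAt g ((p : ℂ), (w : ℂ)) := by
    simp only [hg]
    refine ContinuousAt.div (by fun_prop) (by fun_prop) ?_
    simp only
    positivity
  have hgp : ‖g (p, w)‖ < 1 := by
    have e : g (p, w) = ((2 * (w + a) * (b - t * a) / (p * (t * w + b) ^ 3) : ℝ) : ℂ) := by
      simp only [hg]
      push_cast
      field_simp
      ring
    have h0 : 0 ≤ b - t * a := by linarith
    rw [e, Complex.norm_real, Real.norm_of_nonneg (by positivity), div_lt_one (by positivity)]
    exact hslope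
  obtain ⟨c, hc, hc1⟩ := exists_between hgp
  have hc0 : 0 ≤ c := (norm_nonneg _).trans hc.le
  have htop : ContinuousAt (fun y : ℂ × ℂ => pottsTop t a b k y.1 (y.2, 1)) ((p : ℂ), (w : ℂ)) := by
    simp only [pottsTop]
    refine ContinuousAt.add (ContinuousAt.mul (continuousAt_fst.inv₀ hpc) (by fun_prop))
      (by fun_prop)
  have htop0 : pottsTop t a b k (p : ℂ) ((w : ℂ), 1) ≠ 0 := by
    have := pottsTop_ofReal t a b k p w 1
    rw [Complex.ofReal_one] at this
    rw [this]
    have : 0 < p⁻¹ * (w + a * 1) ^ 3 + k * (t * w + b * 1) ^ 3 := by positivity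
    exact_mod_cast this.ne'
  have hlin : ContinuousAt (fun y : ℂ × ℂ => (t : ℂ) * y.2 + b) ((p : ℂ), (w : ℂ)) := by fun_prop
  have hev : ∀ᶠ y in nhds ((p : ℂ), (w : ℂ)), ‖g y‖ < c ∧ pottsTop t a b k y.1 (y.2, 1) ≠ 0 ∧
      (t : ℂ) * y.2 + b ≠ 0 ∧ y.1 ≠ 0 :=
    (hcon.norm.eventually (gt_mem_nhds hc)).and ((htop.eventually_ne htop0).and
      ((hlin.eventually_ne hdenc).and (continuousAt_fst.eventually_ne hpc)))
  rw [nhds_prod_eq] at hev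
  obtain ⟨P, hP, S, hS, hPS⟩ := Filter.eventually_prod_iff.1 hev
  obtain ⟨r, hr, hrS⟩ := Metric.eventually_nhds_iff.1 hS
  have hshift : ∀ᶠ z in nhds (p : ℂ), ‖f z w - w‖ < (1 - c) * r := by
    have h1 : ContinuousAt (fun z => ‖f z w - w‖) (p : ℂ) := by
      simp only [hf]
      refine ((ContinuousAt.div (by fun_prop) (by fun_prop) ?_).sub continuousAt_const).norm
      positivity
    refine h1.eventually (gt_mem_nhds ?_)
    have : f p w = w := by
      simp only [hf]
      rw [div_eq_iff (by positivity)]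
      have : ((p * w * (t * w + b) ^ 2 : ℝ) : ℂ) = (((w + a) ^ 2 : ℝ) : ℂ) := by rw [hfix]
      push_cast at this
      linear_combination -this
    change ‖f p w - w‖ < (1 - c) * r
    rw [this, sub_self, norm_zero]
    exact mul_pos (by linarith) hr
  obtain ⟨N, hN⟩ : ∃ N, dist (ratioOrbit t a b p (N + 1)) w < r :=
    ((hw.comp (Filter.tendsto_add_atTop_nat 1)).eventually (Metric.ball_mem_nhds w hr)).exists
  obtain ⟨y, hy, e⟩ := pottsOrbit_ofReal ht ha hb hab hp N
  have hyc : (y : ℂ) ≠ 0 := by exact_mod_cast hy.ne'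
  have he1 : (pottsOrbit t a b N p).1 = ((ratioOrbit t a b p (N + 1) * y : ℝ) : ℂ) := by rw [e]
  have he2 : (pottsOrbit t a b N p).2 = (y : ℂ) := by rw [e]
  obtain ⟨hd1, hd2⟩ := pottsOrbit_differentiableAt t a b hpc N
  have hstart : ∀ᶠ z in nhds (p : ℂ), (pottsOrbit t a b N z).2 ≠ 0 ∧
      dist ((pottsOrbit t a b N z).1 / (pottsOrbit t a b N z).2) w < r := by
    refine (hd2.continuousAt.eventually_ne (by rw [he2]; exact hyc)).and ?_
    have hc : ContinuousAt (fun z => (pottsOrbit t a b N z).1 / (pottsOrbit t a b N z).2) (p : ℂ) :=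
      hd1.continuousAt.div hd2.continuousAt (by rw [he2]; exact hyc)
    refine hc.eventually (Metric.isOpen_ball.mem_nhds ?_)
    beta_reduce
    rw [he1, he2, Metric.mem_ball]
    have : ((ratioOrbit t a b p (N + 1) * y : ℝ) : ℂ) / (y : ℂ) =
        (ratioOrbit t a b p (N + 1) : ℂ) := by
      push_cast
      field_simp
    rw [this, Complex.dist_eq, ← Complex.ofReal_sub, Complex.norm_real]
    exact hN
  refine eventually_forall_ne_zero_of_eventually_ge ht ha hb hk hab hp N ?_
  filter_upwards [hP, hshift, hstart] with z hzP hzs hz0 n hn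
  have hinv : ∀ n ≥ N, (pottsOrbit t a b n z).2 ≠ 0 ∧
      dist ((pottsOrbit t a b n z).1 / (pottsOrbit t a b n z).2) w < r := by
    intro n hn
    induction n, hn using Nat.le_induction with
    | base => exact hz0
    | succ n _ ih =>
      obtain ⟨h2, hdist⟩ := ih
      obtain ⟨hgc, -, hl, hz⟩ := hPS hzP (hrS hdist)
      set u := (pottsOrbit t a b n z).1 / (pottsOrbit t a b n z).2 with hu
      have h1 : (pottsOrbit t a b n z).1 = u * (pottsOrbit t a b n z).2 := by
        rw [hu]
        field_simp
      simp only at hl hz hgc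
      have hs : (pottsOrbit t a b (n + 1) z).2 = ((t * u + b) * (pottsOrbit t a b n z).2) ^ 2 := by
        simp only [pottsOrbit, pottsStep]
        rw [h1]
        ring
      have hs2 : (pottsOrbit t a b (n + 1) z).2 ≠ 0 := by
        rw [hs]
        exact pow_ne_zero _ (mul_ne_zero hl h2)
      refine ⟨hs2, ?_⟩
      have hq : (pottsOrbit t a b (n + 1) z).1 / (pottsOrbit t a b (n + 1) z).2 = f z u := by
        rw [hs]
        simp only [hf, pottsOrbit, pottsStep]
        rw [h1]
        field_simp
      rw [hq, dist_eq_norm]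
      rw [dist_eq_norm] at hdist
      calc ‖f z u - w‖ = ‖g (z, u) * (u - w) + (f z w - w)‖ := by
            rw [← hdiff z u hz hl]
            ring_nf
        _ ≤ ‖g (z, u)‖ * ‖u - w‖ + ‖f z w - w‖ := by
            rw [← norm_mul]
            exact norm_add_le _ _
        _ < c * r + (1 - c) * r := by
            refine add_lt_add_of_le_of_lt ?_ hzs
            gcongr
        _ = r := by ring
  obtain ⟨h2, hdist⟩ := hinv n hn
  obtain ⟨-, htp, -, -⟩ := hPS hzP (hrS hdist)
  set u := (pottsOrbit t a b n z).1 / (pottsOrbit t a b n z).2 with hu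
  have h1 : (pottsOrbit t a b n z).1 = u * (pottsOrbit t a b n z).2 := by
    rw [hu]
    field_simp
  have : pottsTop t a b k z (pottsOrbit t a b n z) =
      (pottsOrbit t a b n z).2 ^ 3 * pottsTop t a b k z (u, 1) := by
    simp only [pottsTop]
    rw [h1]
    ring
  rw [this]
  exact mul_ne_zero (pow_ne_zero _ h2) htp

/-- Without interaction between distinct colours no zeros accumulate inside the unit interval. -/
theorem eventually_forall_ne_zero_of_lt_one {k p : ℝ} (hk : 0 < k) (hp : 0 < p) (hp1 : p < 1) :
    ∀ᶠ z in nhds (p : ℂ), ∀ n, pottsTop 0 0 1 k z (pottsOrbit 0 0 1 n z) ≠ 0 := by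
  obtain ⟨r, hpr, hr1⟩ := exists_between hp1
  have hr : 0 < r := hp.trans hpr
  have hpc : (p : ℂ) ≠ 0 := by exact_mod_cast hp.ne'
  have hri : 1 < r⁻¹ := (one_lt_inv₀ hr).2 hr1
  obtain ⟨N, hN⟩ := pow_unbounded_of_one_lt k hri
  refine eventually_forall_ne_zero_of_eventually_ge le_rfl le_rfl one_pos hk (by norm_num) hp N ?_
  have hnorm : ∀ᶠ z in nhds (p : ℂ), ‖z‖ < r := by
    refine continuous_norm.continuousAt.eventually (gt_mem_nhds ?_)
    change ‖(p : ℂ)‖ < r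
    rwa [Complex.norm_real, Real.norm_of_nonneg hp.le]
  filter_upwards [hnorm, eventually_ne_nhds hpc] with z hz hz0 n hn h0
  have hzi : r⁻¹ ≤ ‖z⁻¹‖ := by
    rw [norm_inv]
    exact inv_anti₀ (norm_pos_iff.2 hz0) hz.le
  have horb : ∀ n, (pottsOrbit 0 0 1 n z).2 = 1 ∧ r⁻¹ ^ (n + 1) ≤ ‖(pottsOrbit 0 0 1 n z).1‖ := by
    intro n
    induction n with
    | zero => simpa [pottsOrbit] using hzi
    | succ n ih =>
      obtain ⟨h2, h1⟩ := ih
      have hone : 1 ≤ r⁻¹ ^ (n + 1) := one_le_pow₀ hri.le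
      refine ⟨by simp [pottsOrbit, pottsStep, h2], ?_⟩
      have e : (pottsOrbit 0 0 1 (n + 1) z).1 = z⁻¹ * (pottsOrbit 0 0 1 n z).1 ^ 2 := by
        simp [pottsOrbit, pottsStep]
      rw [e, norm_mul, norm_pow, pow_succ _ (n + 1), mul_comm]
      gcongr
      nlinarith
  obtain ⟨h2, h1⟩ := horb n
  have hone : 1 ≤ r⁻¹ ^ n := one_le_pow₀ hri.le
  have hbig : k < ‖(pottsOrbit 0 0 1 n z).1‖ := by
    refine hN.trans_le (le_trans ?_ h1)
    exact pow_le_pow_right₀ hri.le (by omega)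
  have hge : 1 ≤ ‖(pottsOrbit 0 0 1 n z).1‖ := (one_le_pow₀ hri.le).trans h1
  have e : z⁻¹ * (pottsOrbit 0 0 1 n z).1 ^ 3 = -k := by
    simp only [pottsTop, h2] at h0
    push_cast at h0
    linear_combination h0
  have := congrArg norm e
  rw [norm_mul, norm_pow, norm_neg, Complex.norm_real, Real.norm_of_nonneg hk.le] at this
  have h3 : ‖(pottsOrbit 0 0 1 n z).1‖ ≤ ‖(pottsOrbit 0 0 1 n z).1‖ ^ 3 :=
    le_self_pow₀ hge (by norm_num)
  have h4 : ‖(pottsOrbit 0 0 1 n z).1‖ ^ 3 ≤ ‖z⁻¹‖ * ‖(pottsOrbit 0 0 1 n z).1‖ ^ 3 :=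
    le_mul_of_one_le_left (by positivity) (hri.le.trans hzi)
  linarith

/-- At a positive fixed point `w` of the ratio recursion, the sign of this quadratic polynomial
decides between attraction and repulsion. -/
noncomputable def ratioStability (t a b w : ℝ) : ℝ := t * w ^ 2 + (3 * t * a - b) * w + a * b

theorem eventually_forall_ne_zero_of_ratioStability_pos {t a b k p w : ℝ} (ht : 0 ≤ t)
    (ha : 0 ≤ a) (hb : 0 < b) (hk : 0 < k) (hab : 1 + a = t + b) (hd : t * a ≤ b) (hp : 0 < p)
    (hw : Filter.Tendsto (ratioOrbit t a b p) Filter.atTop (nhds w)) (hw0 : 0 < w)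
    (hQ : 0 < ratioStability t a b w) :
    ∀ᶠ z in nhds (p : ℂ), ∀ n, pottsTop t a b k z (pottsOrbit t a b n z) ≠ 0 := by
  refine eventually_forall_ne_zero_of_attracting ht ha hb hk hab hd hp hw ?_
  obtain ⟨-, hfix⟩ := fixedPoint_of_tendsto_ratioOrbit ht ha hb hp hw
  have h : 0 < (w + a) * ratioStability t a b w := by positivity
  have e : w * (p * (t * w + b) ^ 3) =
      w * (2 * (w + a) * (b - t * a)) + (w + a) * ratioStability t a b w := by
    rw [ratioStability]
    linear_combination (t * w + b) * hfix
  have : w * (2 * (w + a) * (b - t * a)) < w * (p * (t * w + b) ^ 3) := by linarith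
  exact lt_of_mul_lt_mul_left this hw0.le

theorem exists_tendsto_ratioOrbit {t a b x : ℝ} (ht : 0 < t) (ha : 0 < a) (hb : 0 < b)
    (hab : 1 + a = t + b) (hd : t * a ≤ b) (hx : 0 < x) :
    ∃ w, 0 < w ∧ Filter.Tendsto (ratioOrbit t a b x) Filter.atTop (nhds w) := by
  have hbdd : ∀ n, ratioOrbit t a b x n ≤ max 1 (1 / (x * t ^ 2)) := by
    intro n
    cases n with
    | zero => exact le_max_left _ _
    | succ n =>
      refine le_trans ?_ (le_max_right _ _)
      have hs := ratioOrbit_pos ht.le ha.le hb hx n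
      rw [ratioOrbit_succ, div_le_div_iff₀ (by positivity) (by positivity)]
      have : t * (ratioOrbit t a b x n + a) ≤ t * ratioOrbit t a b x n + b := by linarith
      have h2 : (t * (ratioOrbit t a b x n + a)) ^ 2 ≤ (t * ratioOrbit t a b x n + b) ^ 2 := by
        gcongr
      nlinarith
  obtain ⟨w, hw⟩ : ∃ w, Filter.Tendsto (ratioOrbit t a b x) Filter.atTop (nhds w) := by
    rcases le_total x 1 with hx1 | hx1
    · exact ⟨_, tendsto_atTop_ciSup (ratioOrbit_monotone ht.le ha.le hb hab hd hx hx1)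
        ⟨_, Set.forall_mem_range.2 hbdd⟩⟩
    · exact ⟨_, tendsto_atTop_ciInf (ratioOrbit_antitone ht.le ha.le hb hab hd hx hx1)
        ⟨0, Set.forall_mem_range.2 fun n => (ratioOrbit_pos ht.le ha.le hb hx n).le⟩⟩
  refine ⟨w, ?_, hw⟩
  obtain ⟨hw0, hfix⟩ := fixedPoint_of_tendsto_ratioOrbit ht.le ha.le hb hx hw
  refine hw0.lt_of_ne ?_
  rintro rfl
  have : 0 < (0 + a) ^ 2 := by positivity
  simp at hfix
  linarith

/-- Between the initial value and an upper limit, the ratio recursion increases. -/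
theorem le_ratioStep_of_lt_limit {t a b x w v : ℝ} (ht : 0 ≤ t) (ha : 0 ≤ a) (hb : 0 < b)
    (hd : t * a ≤ b) (hx : 0 < x)
    (hw : Filter.Tendsto (ratioOrbit t a b x) Filter.atTop (nhds w)) (h1 : 1 ≤ v) (hv : v < w) :
    x * v * (t * v + b) ^ 2 ≤ (v + a) ^ 2 := by
  classical
  have hex : ∃ n, v < ratioOrbit t a b x n := (hw.eventually (lt_mem_nhds hv)).exists
  obtain ⟨n, hn⟩ : ∃ n, Nat.find hex = n + 1 := by
    refine Nat.exists_eq_succ_of_ne_zero fun h0 => ?_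
    have := Nat.find_spec hex
    rw [h0] at this
    exact absurd h1 (not_le.2 this)
  have h2 : v < ratioOrbit t a b x (n + 1) := hn ▸ Nat.find_spec hex
  have h3 : ratioOrbit t a b x n ≤ v := not_lt.1 (Nat.find_min hex (by omega))
  have h4 := h2.trans_le (ratioStep_mono ht ha hb hd hx (ratioOrbit_pos ht ha hb hx n).le h3)
  rw [lt_div_iff₀ (by positivity)] at h4
  linarith

/-- Between the initial value and a lower limit, the ratio recursion decreases. -/
theorem ratioStep_le_of_limit_lt {t a b x w v : ℝ} (ht : 0 ≤ t) (ha : 0 ≤ a) (hb : 0 < b)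
    (hd : t * a ≤ b) (hx : 0 < x)
    (hw : Filter.Tendsto (ratioOrbit t a b x) Filter.atTop (nhds w)) (h1 : v ≤ 1) (hv : w < v) :
    (v + a) ^ 2 ≤ x * v * (t * v + b) ^ 2 := by
  classical
  obtain ⟨hw0, -⟩ := fixedPoint_of_tendsto_ratioOrbit ht ha hb hx hw
  have hex : ∃ n, ratioOrbit t a b x n < v := (hw.eventually (gt_mem_nhds hv)).exists
  obtain ⟨n, hn⟩ : ∃ n, Nat.find hex = n + 1 := by
    refine Nat.exists_eq_succ_of_ne_zero fun h0 => ?_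
    have := Nat.find_spec hex
    rw [h0] at this
    exact absurd h1 (not_le.2 this)
  have h2 : ratioOrbit t a b x (n + 1) < v := hn ▸ Nat.find_spec hex
  have h3 : v ≤ ratioOrbit t a b x n := not_lt.1 (Nat.find_min hex (by omega))
  have h4 := (ratioStep_mono ht ha hb hd hx (hw0.trans hv.le) h3).trans_lt h2
  have : 0 < v := hw0.trans_lt hv
  rw [div_lt_iff₀ (by positivity)] at h4
  linarith

theorem ratioStability_fixedPoint_eq {t a b x w : ℝ} (hw : x * w * (t * w + b) ^ 2 = (w + a) ^ 2) :
    w * (t * w + b) * (2 * (w + a) - x * (t * w + b) * (3 * t * w + b)) =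
      -((w + a) * ratioStability t a b w) := by
  rw [ratioStability]
  linear_combination -(3 * t * w + b) * hw

/-- At a fixed point with vanishing stability, the recursion satisfies the equations of a double
root, and the sign of its second order term is explicit. -/
theorem double_root_of_ratioStability_eq_zero {t a b x w : ℝ} (ht : 0 ≤ t)
    (hb : 0 < b) (hw0 : 0 < w) (hw : x * w * (t * w + b) ^ 2 = (w + a) ^ 2)
    (hQ : ratioStability t a b w = 0) :
    2 * (w + a) = x * (t * w + b) * (3 * t * w + b) ∧
    (t * w + b) * (3 * t * w + b) * (1 - x * (3 * t ^ 2 * w + 2 * t * b)) =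
      (b - t * a) * (b - 3 * t * w) := by
  have h1 := ratioStability_fixedPoint_eq hw
  rw [hQ, mul_zero, neg_zero] at h1
  have h2 : 2 * (w + a) = x * (t * w + b) * (3 * t * w + b) := by
    have := (mul_eq_zero.1 h1).resolve_left (by positivity)
    linarith
  refine ⟨h2, ?_⟩
  rw [ratioStability] at hQ
  linear_combination (3 * t ^ 2 * w + 2 * t * b) * h2 - 3 * t * hQ

/-- Factorization of the fixed point equation at a root `w`. -/
theorem ratioStep_sub_factor {t a b x w : ℝ} (hw : x * w * (t * w + b) ^ 2 = (w + a) ^ 2) (v : ℝ) :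
    (v + a) ^ 2 - x * v * (t * v + b) ^ 2 = (v - w) *
      (2 * (w + a) - x * (t * w + b) * (3 * t * w + b) +
        (v - w) * (1 - x * (t ^ 2 * (v + 2 * w) + 2 * t * b))) := by
  linear_combination -hw

theorem ratioStability_nonneg_of_lower {t a b x w : ℝ} (ht : 0 ≤ t) (ha : 0 ≤ a)
    (hb : 0 < b) (hw1 : 1 < w) (hw : x * w * (t * w + b) ^ 2 = (w + a) ^ 2)
    (hv : ∀ v, 1 ≤ v → v < w → x * v * (t * v + b) ^ 2 ≤ (v + a) ^ 2) :
    0 ≤ ratioStability t a b w ∧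
      (ratioStability t a b w = 0 → 0 ≤ (b - t * a) * (b - 3 * t * w)) := by
  have hw0 : 0 < w := by linarith
  have hev : ∀ᶠ v in nhdsWithin w (Set.Iio w), 1 ≤ v ∧ v < w :=
    ((lt_mem_nhds hw1).filter_mono nhdsWithin_le_nhds |>.mono fun v h => le_of_lt h).and
      self_mem_nhdsWithin
  have hG : ∀ v, 1 ≤ v → v < w → 2 * (w + a) - x * (t * w + b) * (3 * t * w + b) +
        (v - w) * (1 - x * (t ^ 2 * (v + 2 * w) + 2 * t * b)) ≤ 0 := by
    intro v h1 h2
    have := ratioStep_sub_factor hw v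
    have := hv v h1 h2
    by_contra hpos
    have := mul_neg_of_neg_of_pos (sub_neg.2 h2) (not_le.1 hpos)
    linarith
  constructor
  · have hc : Filter.Tendsto (fun v => 2 * (w + a) - x * (t * w + b) * (3 * t * w + b) +
        (v - w) * (1 - x * (t ^ 2 * (v + 2 * w) + 2 * t * b))) (nhdsWithin w (Set.Iio w))
        (nhds (2 * (w + a) - x * (t * w + b) * (3 * t * w + b) +
        (w - w) * (1 - x * (t ^ 2 * (w + 2 * w) + 2 * t * b)))) :=
      Continuous.tendsto' (by fun_prop) _ _ rfl |>.mono_left nhdsWithin_le_nhds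
    have hle := le_of_tendsto hc (hev.mono fun v h => hG v h.1 h.2)
    have e := ratioStability_fixedPoint_eq hw
    rw [sub_self, zero_mul, add_zero] at hle
    have : 0 < w * (t * w + b) := by positivity
    have h3 := mul_nonpos_of_nonneg_of_nonpos this.le hle
    rw [e] at h3
    have : 0 < w + a := by positivity
    exact nonneg_of_mul_nonneg_right (by linarith) this
  · intro hQ
    obtain ⟨h1, h2⟩ := double_root_of_ratioStability_eq_zero ht hb hw0 hw hQ
    rw [← h2]
    have hc : Filter.Tendsto (fun v => 1 - x * (t ^ 2 * (v + 2 * w) + 2 * t * b))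
        (nhdsWithin w (Set.Iio w)) (nhds (1 - x * (3 * t ^ 2 * w + 2 * t * b))) :=
      Continuous.tendsto' (by fun_prop) _ _ (by ring) |>.mono_left nhdsWithin_le_nhds
    have : 0 ≤ 1 - x * (3 * t ^ 2 * w + 2 * t * b) := by
      refine ge_of_tendsto hc (hev.mono fun v h => ?_)
      have := hG v h.1 h.2
      rw [h1, sub_self, zero_add] at this
      exact nonneg_of_mul_nonpos_right this (sub_neg.2 h.2)
    positivity

theorem ratioStability_nonneg_of_upper {t a b x w : ℝ} (ht : 0 ≤ t) (ha : 0 ≤ a)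
    (hb : 0 < b) (hw0 : 0 < w) (hw1 : w < 1) (hw : x * w * (t * w + b) ^ 2 = (w + a) ^ 2)
    (hv : ∀ v, v ≤ 1 → w < v → (v + a) ^ 2 ≤ x * v * (t * v + b) ^ 2) :
    0 ≤ ratioStability t a b w ∧
      (ratioStability t a b w = 0 → (b - t * a) * (b - 3 * t * w) ≤ 0) := by
  have hev : ∀ᶠ v in nhdsWithin w (Set.Ioi w), v ≤ 1 ∧ w < v :=
    ((gt_mem_nhds hw1).filter_mono nhdsWithin_le_nhds |>.mono fun v h => le_of_lt h).and
      self_mem_nhdsWithin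
  have hG : ∀ v, v ≤ 1 → w < v → 2 * (w + a) - x * (t * w + b) * (3 * t * w + b) +
        (v - w) * (1 - x * (t ^ 2 * (v + 2 * w) + 2 * t * b)) ≤ 0 := by
    intro v h1 h2
    have := ratioStep_sub_factor hw v
    have := hv v h1 h2
    by_contra hpos
    have := mul_pos (sub_pos.2 h2) (not_le.1 hpos)
    linarith
  constructor
  · have hc : Filter.Tendsto (fun v => 2 * (w + a) - x * (t * w + b) * (3 * t * w + b) +
        (v - w) * (1 - x * (t ^ 2 * (v + 2 * w) + 2 * t * b))) (nhdsWithin w (Set.Ioi w))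
        (nhds (2 * (w + a) - x * (t * w + b) * (3 * t * w + b) +
        (w - w) * (1 - x * (t ^ 2 * (w + 2 * w) + 2 * t * b)))) :=
      Continuous.tendsto' (by fun_prop) _ _ rfl |>.mono_left nhdsWithin_le_nhds
    have hle := le_of_tendsto hc (hev.mono fun v h => hG v h.1 h.2)
    have e := ratioStability_fixedPoint_eq hw
    rw [sub_self, zero_mul, add_zero] at hle
    have : 0 < w * (t * w + b) := by positivity
    have h3 := mul_nonpos_of_nonneg_of_nonpos this.le hle
    rw [e] at h3
    have : 0 < w + a := by positivity
    exact nonneg_of_mul_nonneg_right (by linarith) this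
  · intro hQ
    obtain ⟨h1, h2⟩ := double_root_of_ratioStability_eq_zero ht hb hw0 hw hQ
    rw [← h2]
    have hc : Filter.Tendsto (fun v => 1 - x * (t ^ 2 * (v + 2 * w) + 2 * t * b))
        (nhdsWithin w (Set.Ioi w)) (nhds (1 - x * (3 * t ^ 2 * w + 2 * t * b))) :=
      Continuous.tendsto' (by fun_prop) _ _ (by ring) |>.mono_left nhdsWithin_le_nhds
    have : 1 - x * (3 * t ^ 2 * w + 2 * t * b) ≤ 0 := by
      refine le_of_tendsto hc (hev.mono fun v h => ?_)
      have := hG v h.1 h.2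
      rw [h1, sub_self, zero_add] at this
      exact nonpos_of_mul_nonpos_right this (sub_pos.2 h.2)
    exact mul_nonpos_of_nonneg_of_nonpos (by positivity) this

/-- If no zeros accumulate at `p`, the limiting ratio has a derivative at `p` satisfying the
implicit equation. -/
theorem exists_hasDerivAt_limit_of_zero_free {t a b k p M : ℝ} (ht : 0 ≤ t) (hb : 0 < b)
    (hk : 0 < k) (ha : a = k * t) (hab : 1 + a = t + b) (hbt : 4 * t ^ 2 * k < b) (hp : 0 < p)
    (hM : ∀ n, ratioOrbit t a b p n ≤ M)
    (hfree : ∀ᶠ z in nhds (p : ℂ), ∀ n, pottsTop t a b k z (pottsOrbit t a b n z) ≠ 0) :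
    ∃ (ω : ℝ → ℝ) (d : ℝ), HasDerivAt ω d p ∧
      (∀ᶠ x in nhds p, Filter.Tendsto (ratioOrbit t a b x) Filter.atTop (nhds (ω x))) ∧
      (ω p) ^ 2 * (t * ω p + b) ^ 3 = -(d * ((ω p + a) * ratioStability t a b (ω p))) := by
  have ha0 : 0 ≤ a := by rw [ha]; positivity
  obtain ⟨ω, hω, hlim⟩ := differentiableAt_limit_of_zero_free ht hb hk ha hab hbt hp hM hfree
  refine ⟨ω, deriv ω p, hω.hasDerivAt, hlim, ?_⟩
  have hfix : ∀ᶠ x in nhds p, x * ω x * (t * ω x + b) ^ 2 - (ω x + a) ^ 2 = 0 := by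
    filter_upwards [hlim, lt_mem_nhds hp] with x hx hx0
    rw [(fixedPoint_of_tendsto_ratioOrbit ht ha0 hb hx0 hx).2, sub_self]
  have h0 : HasDerivAt (fun x => x * ω x * (t * ω x + b) ^ 2 - (ω x + a) ^ 2) 0 p :=
    (hasDerivAt_const p (0 : ℝ)).congr_of_eventuallyEq hfix
  have hd := hω.hasDerivAt
  have h1 := (((hasDerivAt_id p).mul hd).mul (((hd.const_mul t).add_const b).pow 2)).sub
    ((hd.add_const a).pow 2)
  have h2 := h0.unique h1
  have e := ratioStability_fixedPoint_eq (sub_eq_zero.1 hfix.self_of_nhds)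
  simp only [id, Pi.mul_apply, Pi.pow_apply] at h2
  push_cast at h2
  linear_combination -(ω p * (t * ω p + b)) * h2 + deriv ω p * e

theorem ratioOrbit_at_one {t a b : ℝ} (ht : 0 ≤ t) (hb : 0 < b) (hab : 1 + a = t + b) (n : ℕ) :
    ratioOrbit t a b 1 n = 1 := by
  induction n with
  | zero => rfl
  | succ n ih =>
    have : t + b ≠ 0 := by positivity
    rw [ratioOrbit_succ, ih, mul_one, one_mul, hab, div_self (by positivity)]

/-- Zeros accumulate at `1` when the fixed point `1` is not attracting. -/
theorem not_eventually_forall_ne_zero_one {t a b k : ℝ} (ht : 0 ≤ t) (hb : 0 < b)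
    (hk : 0 < k) (ha : a = k * t) (hab : 1 + a = t + b) (hbt : 4 * t ^ 2 * k < b)
    (hQ : ratioStability t a b 1 ≤ 0) :
    ¬∀ᶠ z in nhds ((1 : ℝ) : ℂ), ∀ n, pottsTop t a b k z (pottsOrbit t a b n z) ≠ 0 := by
  intro hfree
  have ha0 : 0 ≤ a := by rw [ha]; positivity
  have hd : t * a ≤ b := by
    rw [ha]
    have : 0 ≤ t ^ 2 * k := by positivity
    nlinarith
  obtain ⟨ω, d, hω, hlim, heq⟩ := exists_hasDerivAt_limit_of_zero_free ht hb hk ha hab hbt one_pos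
    (fun n => (ratioOrbit_at_one ht hb hab n).le) hfree
  have h1 : ω 1 = 1 := by
    refine tendsto_nhds_unique hlim.self_of_nhds ?_
    simp [funext (ratioOrbit_at_one ht hb hab)]
  have hd0 : d ≤ 0 := by
    have hs := (hasDerivAt_iff_tendsto_slope.1 hω).mono_left
      (nhdsWithin_mono 1 fun x (hx : x ∈ Set.Ioi 1) => (ne_of_gt hx : x ≠ 1))
    refine le_of_tendsto hs ?_
    filter_upwards [hlim.filter_mono nhdsWithin_le_nhds, self_mem_nhdsWithin] with x hx hx1
    have hx1 : 1 < x := hx1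
    have hle : ω x ≤ 1 := le_of_tendsto' hx fun n =>
      ratioOrbit_antitone ht ha0 hb hab hd (by linarith) hx1.le (Nat.zero_le n)
    rw [slope_def_field, h1]
    exact div_nonpos_of_nonpos_of_nonneg (by linarith) (by linarith)
  rw [h1] at heq
  have h2 : 0 ≤ d * ((1 + a) * ratioStability t a b 1) :=
    mul_nonneg_of_nonpos_of_nonpos hd0 (mul_nonpos_of_nonneg_of_nonpos (by linarith) hQ)
  have h3 : 0 < (1 : ℝ) ^ 2 * (t * 1 + b) ^ 3 := by positivity
  linarith

/-- Zeros accumulate at the parameter for which the first fixed point above `1` is parabolic. -/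
theorem not_eventually_forall_ne_zero_parabolic {t a b k p w : ℝ} (ht : 0 < t) (hb : 0 < b)
    (hk : 0 < k) (ha : a = k * t) (hab : 1 + a = t + b) (hbt : 4 * t ^ 2 * k < b) (hp : 0 < p)
    (hw1 : 1 ≤ w) (hfix : p * w * (t * w + b) ^ 2 = (w + a) ^ 2)
    (hQ : ratioStability t a b w = 0) (hwb : 3 * t * w ≤ b) :
    ¬∀ᶠ z in nhds (p : ℂ), ∀ n, pottsTop t a b k z (pottsOrbit t a b n z) ≠ 0 := by
  intro hfree
  have hw0 : 0 < w := by linarith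
  have ha0 : 0 < a := by rw [ha]; positivity
  have hd : t * a ≤ b := by
    rw [ha]
    have : 0 ≤ t ^ 2 * k := by positivity
    nlinarith
  have hM : ∀ n, ratioOrbit t a b p n ≤ w := by
    intro n
    induction n with
    | zero => exact hw1
    | succ n ih =>
      refine (ratioStep_mono ht.le ha0.le hb hd hp
        (ratioOrbit_pos ht.le ha0.le hb hp n).le ih).trans_eq ?_
      rw [div_eq_iff (by positivity)]
      linarith
  obtain ⟨ω, d, -, hlim, heq⟩ := exists_hasDerivAt_limit_of_zero_free ht.le hb hk ha hab hbt hp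
    hM hfree
  obtain ⟨h0, hfix'⟩ := fixedPoint_of_tendsto_ratioOrbit ht.le ha0.le hb hp hlim.self_of_nhds
  have hle : ω p ≤ w := le_of_tendsto' hlim.self_of_nhds hM
  have hpos : 0 < ω p := by
    refine h0.lt_of_ne fun h => ?_
    rw [← h] at hfix'
    have : 0 < (0 + a) ^ 2 := by positivity
    simp at hfix'
    linarith
  have hww : ω p = w := by
    by_contra hne
    have hlt : ω p < w := lt_of_le_of_ne hle hne
    obtain ⟨e1, e2⟩ := double_root_of_ratioStability_eq_zero ht.le hb hw0 hfix hQ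
    have hH : 0 ≤ 1 - p * (3 * t ^ 2 * w + 2 * t * b) := by
      have : 0 ≤ (b - t * a) * (b - 3 * t * w) :=
        mul_nonneg (by linarith) (by linarith)
      rw [← e2] at this
      exact nonneg_of_mul_nonneg_right this (by positivity)
    have e3 := ratioStep_sub_factor hfix (ω p)
    rw [hfix', sub_self, e1, sub_self, zero_add, ← mul_assoc] at e3
    have hne' : ω p - w ≠ 0 := sub_ne_zero.2 hne
    have e4 := (mul_eq_zero.1 e3.symm).resolve_left (mul_ne_zero hne' hne')
    have : 0 < p * (t ^ 2 * (w - ω p)) :=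
      mul_pos hp (mul_pos (by positivity) (sub_pos.2 hlt))
    nlinarith
  rw [hww, hQ, mul_zero, mul_zero, neg_zero] at heq
  have : 0 < w ^ 2 * (t * w + b) ^ 3 := by positivity
  linarith

theorem ratioStability_pos {t a b w : ℝ} (ht : 0 < t) (ha : 0 < a) (hd : t * a ≤ b)
    (h9 : b < 9 * (t * a)) (hw : 0 < w) : 0 < ratioStability t a b w := by
  have hW : 0 < t * w := by positivity
  have hm : 0 < t * a := by positivity
  have e : 4 * t * ratioStability t a b w =
      (2 * (t * w) - (b - 3 * (t * a))) ^ 2 + (b - t * a) * (9 * (t * a) - b) := by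
    rw [ratioStability]
    ring
  rcases hd.eq_or_lt with h | h
  · have e' : ratioStability t a b w = t * w ^ 2 + 2 * (t * a) * w + a * (t * a) := by
      rw [ratioStability, ← h]
      ring
    rw [e']
    positivity
  · have h1 : 0 < (b - t * a) * (9 * (t * a) - b) := mul_pos (by linarith) (by linarith)
    have h2 : 0 < 4 * t * ratioStability t a b w := by
      rw [e]
      positivity
    exact pos_of_mul_pos_right h2 (by positivity)

theorem le_of_ratioStability_eq_zero {t a b w : ℝ} (ht : 0 < t) (hw : 0 < w)
    (hQ : ratioStability t a b w = 0) (h3 : 3 * (t * w) ≤ b) : w ≤ 3 * a := by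
  rw [ratioStability] at hQ
  have hW : 0 < t * w := by positivity
  have e : (b - 3 * (t * w)) * (t * w - 3 * (t * a)) = -(2 * (b - 9 * (t * a)) * (t * w)) := by
    linear_combination -3 * t * hQ
  by_contra! h
  have h4 : 0 < t * w - 3 * (t * a) := by nlinarith
  have h5 : 0 ≤ (b - 3 * (t * w)) * (t * w - 3 * (t * a)) := mul_nonneg (by linarith) h4.le
  have h6 : 0 < 2 * (b - 9 * (t * a)) * (t * w) := mul_pos (by linarith) hW
  linarith

/-- Away from the exceptional parameters, no zeros accumulate on the positive axis. -/
theorem eventually_forall_ne_zero_of_regular {t a b k p : ℝ} (ht : 0 < t) (hk : 1 ≤ k)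
    (ha : a = k * t) (hb : b = 1 + (k - 1) * t) (hd : t * a ≤ b) (hp : 0 < p)
    (hone : p = 1 → 0 < ratioStability t a b 1)
    (hdouble : p < 1 → 9 * (t * a) ≤ b → ∀ w, 1 < w → p * w * (t * w + b) ^ 2 = (w + a) ^ 2 →
      w ≤ 3 * a → ratioStability t a b w ≠ 0) :
    ∀ᶠ z in nhds (p : ℂ), ∀ n, pottsTop t a b k z (pottsOrbit t a b n z) ≠ 0 := by
  have hk0 : 0 < k := by linarith
  have ha0 : 0 < a := by rw [ha]; positivity
  have hb1 : 1 ≤ b := by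
    rw [hb]
    nlinarith [mul_nonneg (sub_nonneg.2 hk) ht.le]
  have hb0 : 0 < b := by linarith
  have hab : 1 + a = t + b := by rw [ha, hb]; ring
  obtain ⟨w, hw0, hw⟩ := exists_tendsto_ratioOrbit ht ha0 hb0 hab hd hp
  refine eventually_forall_ne_zero_of_ratioStability_pos ht.le ha0.le hb0 hk0 hab hd hp hw hw0 ?_
  rcases lt_or_ge b (9 * (t * a)) with h9 | h9
  · exact ratioStability_pos ht ha0 hd h9 hw0
  obtain ⟨-, hfix⟩ := fixedPoint_of_tendsto_ratioOrbit ht.le ha0.le hb0 hp hw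
  have hm : 0 < t * a := by positivity
  have hbm : 0 < b - t * a := by linarith
  rcases lt_trichotomy p 1 with hp1 | hp1 | hp1
  · have hw1 : 1 < w := by
      have h1 := (ratioOrbit_monotone ht.le ha0.le hb0 hab hd hp hp1.le).ge_of_tendsto hw 1
      rw [ratioOrbit_one ht.le hb0 hab] at h1
      exact ((one_lt_div hp).2 hp1).trans_le h1
    obtain ⟨h1, h2⟩ := ratioStability_nonneg_of_lower ht.le ha0.le hb0 hw1 hfix
      fun v => le_ratioStep_of_lt_limit ht.le ha0.le hb0 hd hp hw
    refine h1.lt_of_ne fun h => ?_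
    have h3 := nonneg_of_mul_nonneg_right (h2 h.symm) hbm
    exact hdouble hp1 h9 w hw1 hfix
      (le_of_ratioStability_eq_zero ht hw0 h.symm (by linarith)) h.symm
  · have : w = 1 := by
      refine tendsto_nhds_unique hw ?_
      rw [hp1]
      simp [funext (ratioOrbit_at_one ht.le hb0 hab)]
    rw [this]
    exact hone hp1
  · have hw1 : w < 1 := by
      have h1 := (ratioOrbit_antitone ht.le ha0.le hb0 hab hd hp hp1.le).le_of_tendsto hw 1
      rw [ratioOrbit_one ht.le hb0 hab] at h1
      exact h1.trans_lt ((div_lt_one hp).2 hp1)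
    obtain ⟨h1, h2⟩ := ratioStability_nonneg_of_upper ht.le ha0.le hb0 hw0 hw1 hfix
      fun v => ratioStep_le_of_limit_lt ht.le ha0.le hb0 hd hp hw
    refine h1.lt_of_ne fun h => ?_
    have h3 := nonpos_of_mul_nonpos_right (h2 h.symm) hbm
    have h4 : b < 3 * t := by nlinarith
    have h5 : 3 * (k * t) * t < 1 * t := by
      rw [ha] at h9
      linarith
    have h6 : 3 * (k * t) < 1 := lt_of_mul_lt_mul_right h5 ht.le
    nlinarith

theorem ratioStability_one {t a b k : ℝ} (ha : a = k * t) (hb : b = 1 + (k - 1) * t) :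
    ratioStability t a b 1 = ((k + 2) * t - 1) * (k * t + 1) := by
  rw [ratioStability, ha, hb]
  ring

/-- The parameter at which the smaller root of `ratioStability` is a fixed point. -/
theorem double_root_parameter {t a b s : ℝ} (ht : 0 < t) (ha : 0 < a) (hb : 0 < b)
    (h9 : 9 * (t * a) ≤ b)
    (hs : s ^ 2 = (b - t * a) * (b - 9 * (t * a))) :
    let w := (b - 3 * (t * a) - s) / (2 * t)
    0 < w ∧ ratioStability t a b w = 0 ∧
      (b ^ 2 + 18 * (t * a) * b - 27 * (t * a) ^ 2 - (b - 9 * (t * a)) * s) / (8 * t * b ^ 3) =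
        (w + a) ^ 2 / (w * (t * w + b) ^ 2) := by
  intro w
  have hm : 0 < t * a := by positivity
  have hs1 : s < b - 3 * (t * a) := by
    refine lt_of_pow_lt_pow_left₀ 2 (by linarith) ?_
    rw [hs]
    nlinarith
  have hw0 : 0 < w := div_pos (by linarith) (by positivity)
  have hW : s = b - 3 * (t * a) - 2 * (t * w) := by
    simp only [w]
    field_simp
    ring
  have hQ : ratioStability t a b w = 0 := by
    have : 4 * t * ratioStability t a b w = 0 := by
      rw [ratioStability]
      rw [hW] at hs
      linear_combination hs
    exact (mul_eq_zero.1 this).resolve_left (by positivity)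
  refine ⟨hw0, hQ, ?_⟩
  rw [div_eq_div_iff (by positivity) (by positivity), hW]
  rw [ratioStability] at hQ
  linear_combination (2 * (b - 9 * (t * a)) * (t * w) ^ 2 +
    (6 * b ^ 2 - 30 * (t * a) * b) * (t * w) - 8 * b ^ 2 * (t * a)) * hQ

theorem ZZpair_eq_pottsOrbit (q : ℕ) (t : ℝ) (n : ℕ) (z : ℂ) : ZZpair q t n z =
    pottsOrbit t (((q : ℝ) - 1) * t) (1 + ((q : ℝ) - 2) * t) n z := by
  induction n with
  | zero => rfl
  | succ n ih =>
    rw [ZZpair, pottsOrbit, pottsStep, ih]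
    push_cast
    rfl

theorem notMem_BLYhat_iff {q : ℕ} {t p : ℝ} (hp : 0 < p) : (p : ℂ) ∉ BLYhat t q ↔
    ∀ᶠ z in nhds (p : ℂ), ∀ n, pottsTop t (((q : ℝ) - 1) * t) (1 + ((q : ℝ) - 2) * t)
      ((q : ℝ) - 1) z
      (pottsOrbit t (((q : ℝ) - 1) * t) (1 + ((q : ℝ) - 2) * t) n z) ≠ 0 := by
  have hpc : (p : ℂ) ≠ 0 := by exact_mod_cast hp.ne'
  have e : ∀ n z, Zunrooted q t (n + 1) z = pottsTop t (((q : ℝ) - 1) * t)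
      (1 + ((q : ℝ) - 2) * t) ((q : ℝ) - 1) z
      (pottsOrbit t (((q : ℝ) - 1) * t) (1 + ((q : ℝ) - 2) * t) n z) := by
    intro n z
    rw [Zunrooted, Nat.add_sub_cancel, ZZpair_eq_pottsOrbit, pottsTop]
    push_cast
    rfl
  rw [BLYhat, mem_closure_iff_frequently, Filter.not_frequently]
  constructor
  · intro h
    filter_upwards [h, eventually_ne_nhds hpc] with z hz hz0 n h0
    exact hz ⟨hz0, n + 1, by omega, by rw [e, h0]⟩
  · intro h
    filter_upwards [h] with z hz
    rintro ⟨-, n, hn, h0⟩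
    obtain ⟨m, rfl⟩ := Nat.exists_eq_add_of_le' hn
    exact hz m (by rw [← e, h0])

theorem BLYhat_inter_posAxis_eq_singleton {q : ℕ} {t p : ℝ} (hp : 0 < p)
    (hmem : (p : ℂ) ∈ BLYhat t q) (h : ∀ x : ℝ, 0 < x → x ≠ p → (x : ℂ) ∉ BLYhat t q) :
    BLYhat t q ∩ posAxis = {(p : ℂ)} := by
  refine Set.Subset.antisymm ?_ (Set.singleton_subset_iff.2 ⟨hmem, p, hp, rfl⟩)
  rintro _ ⟨hz, x, hx, rfl⟩
  by_contra hne
  exact h x hx (fun e => hne (by rw [e]; rfl)) hz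

theorem le_tTwo_iff {k t : ℝ} (hk : 1 ≤ k) (ht : 0 ≤ t) :
    t ≤ tTwo (k + 1) ↔ 9 * k * t ^ 2 ≤ 1 + (k - 1) * t := by
  have hk0 : 0 < k := by linarith
  rw [tTwo, le_div_iff₀ (by linarith)]
  have e : (18 * k * t - (k - 1)) ^ 2 - ((k + 1) ^ 2 + 32 * (k + 1) - 32) =
      36 * k * (9 * k * t ^ 2 - (1 + (k - 1) * t)) := by ring
  constructor
  · intro h
    have h1 : 18 * k * t - (k - 1) ≤ √((k + 1) ^ 2 + 32 * (k + 1) - 32) := by linarith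
    have h0 : (k - 1) ^ 2 ≤ (k + 1) ^ 2 + 32 * (k + 1) - 32 := by nlinarith
    have h2 : k - 1 ≤ √((k + 1) ^ 2 + 32 * (k + 1) - 32) := Real.le_sqrt_of_sq_le h0
    have h3 : -√((k + 1) ^ 2 + 32 * (k + 1) - 32) ≤ 18 * k * t - (k - 1) := by
      have : 0 ≤ k * t := by positivity
      linarith
    have h4 := sq_le_sq' h3 h1
    rw [Real.sq_sqrt (by nlinarith)] at h4
    by_contra! h5
    have : 0 < 36 * k * (9 * k * t ^ 2 - (1 + (k - 1) * t)) :=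
      mul_pos (by linarith) (by linarith)
    linarith
  · intro h
    have h1 : 36 * k * (9 * k * t ^ 2 - (1 + (k - 1) * t)) ≤ 0 :=
      mul_nonpos_of_nonneg_of_nonpos (by linarith) (by linarith)
    have h2 : 18 * k * t - (k - 1) ≤ √((k + 1) ^ 2 + 32 * (k + 1) - 32) :=
      Real.le_sqrt_of_sq_le (by linarith)
    linarith

theorem le_tOne_iff {k t : ℝ} (hk : 1 ≤ k) : t ≤ tOne (k + 1) ↔ (k + 2) * t ≤ 1 := by
  have : 0 < 1 + (k + 1) := by linarith
  rw [tOne, le_div_iff₀ this]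
  constructor <;> intro h <;> linarith

theorem nine_mul_le_of_le_tOne {k t : ℝ} (hk : 1 ≤ k) (ht : 0 ≤ t) (h : (k + 2) * t ≤ 1) :
    9 * k * t ^ 2 ≤ 1 + (k - 1) * t := by
  have hu : 0 ≤ (k + 2) * t := by positivity
  have e : (k + 2) ^ 2 * (1 + (k - 1) * t - 9 * k * t ^ 2) =
      (1 - (k + 2) * t) * (k + 2) ^ 2 + (k + 2) * t * (2 * (k - 1) ^ 2) +
        9 * k * ((k + 2) * t * (1 - (k + 2) * t)) := by ring
  have h1 : 0 ≤ 1 - (k + 2) * t := by linarith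
  have h2 : 0 ≤ (k + 2) ^ 2 * (1 + (k - 1) * t - 9 * k * t ^ 2) := by
    rw [e]
    positivity
  have := nonneg_of_mul_nonneg_right h2 (by positivity)
  linarith

theorem calZ_eq {t a b k : ℝ} (ha : a = k * t) (hb : b = 1 + (k - 1) * t)
    (h9 : 9 * (t * a) ≤ b) :
    calZ (k + 1) t = (b ^ 2 + 18 * (t * a) * b - 27 * (t * a) ^ 2 -
      (b - 9 * (t * a)) * √((b - t * a) * (b - 9 * (t * a)))) / (8 * t * b ^ 3) := by
  have e1 : (t - 1) * ((k + 1 - 1) * t + 1) *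
      (9 * (k + 1 - 1) * t ^ 2 - (k + 1 - 2) * t - 1) ^ 3 =
      (b - 9 * (t * a)) ^ 2 * ((b - t * a) * (b - 9 * (t * a))) := by
    rw [ha, hb]
    ring
  have e2 : √((t - 1) * ((k + 1 - 1) * t + 1) *
      (9 * (k + 1 - 1) * t ^ 2 - (k + 1 - 2) * t - 1) ^ 3) =
      (b - 9 * (t * a)) * √((b - t * a) * (b - 9 * (t * a))) := by
    rw [e1, Real.sqrt_mul (sq_nonneg _), Real.sqrt_sq (by linarith)]
  rw [calZ, e2]
  congr 1
  · rw [ha, hb]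
    ring
  · rw [hb]
    ring

/-- **Theorem A (unrooted case).** For `q ≥ 2` and `0 ≤ t ≤ 1`, the intersection of the
accumulation set of Lee–Yang zeros of the unrooted binary Cayley tree with `(0,∞)` is
`{1}` for `0 ≤ t ≤ t₁(q)`, is `{𝒵_q(t)}` for `t₁(q) < t ≤ t₂(q)`, and is empty for
`t₂(q) < t ≤ 1`. -/
theorem potts_unrooted_ferromagnetic_accumulation
    (q : ℕ) (hq : 2 ≤ q) (t : ℝ) (ht0 : 0 ≤ t) (ht1 : t ≤ 1) :
    (t ≤ tOne q → BLYhat t q ∩ posAxis = {(1 : ℂ)}) ∧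
    (tOne q < t → t ≤ tTwo q → BLYhat t q ∩ posAxis = {((calZ q t : ℝ) : ℂ)}) ∧
    (tTwo q < t → BLYhat t q ∩ posAxis = ∅) := by
  obtain ⟨k, hk⟩ : ∃ k : ℝ, (q : ℝ) = k + 1 := ⟨q - 1, by ring⟩
  have hk1 : 1 ≤ k := by
    have : (2 : ℝ) ≤ q := by exact_mod_cast hq
    linarith
  have hk0 : 0 < k := by linarith
  obtain ⟨a, ha⟩ : ∃ a, a = k * t := ⟨_, rfl⟩
  obtain ⟨b, hb⟩ : ∃ b, b = 1 + (k - 1) * t := ⟨_, rfl⟩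
  have hmem : ∀ p : ℝ, 0 < p → ((p : ℂ) ∉ BLYhat t q ↔
      ∀ᶠ z in nhds (p : ℂ), ∀ n, pottsTop t a b k z (pottsOrbit t a b n z) ≠ 0) := by
    intro p hp
    have e1 : (q : ℝ) - 1 = k := by linarith
    have e2 : (q : ℝ) - 2 = k - 1 := by linarith
    rw [notMem_BLYhat_iff hp, e1, e2, ← ha, ← hb]
  have hab : 1 + a = t + b := by rw [ha, hb]; ring
  have ha0 : 0 ≤ a := by rw [ha]; positivity
  have hb1 : 1 ≤ b := by
    rw [hb]
    linarith [mul_nonneg (sub_nonneg.2 hk1) ht0]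
  have hb0 : 0 < b := by linarith
  have hd : t * a ≤ b := by
    have : b - t * a = (1 - t) * (1 + a) := by
      rw [ha, hb]
      ring
    have : 0 ≤ (1 - t) * (1 + a) := mul_nonneg (by linarith) (by linarith)
    linarith
  have h9iff : 9 * k * t ^ 2 ≤ 1 + (k - 1) * t ↔ 9 * (t * a) ≤ b := by
    rw [ha, hb]
    constructor <;> intro h <;> linarith
  have hparab : 9 * (t * a) ≤ b → 4 * t ^ 2 * k < b := by
    intro h
    have : t * a = t ^ 2 * k := by rw [ha]; ring
    linarith
  have hsing : ∀ p : ℝ, p = 1 → ((p : ℂ) = 1) := fun p h => by rw [h, Complex.ofReal_one]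
  rw [hk, le_tOne_iff hk1, ← not_le, ← not_le, le_tOne_iff hk1, le_tTwo_iff hk1 ht0, h9iff]
  refine ⟨fun h1 => ?_, fun h1 h2 => ?_, fun h2 => ?_⟩
  · have h9 := h9iff.1 (nine_mul_le_of_le_tOne hk1 ht0 h1)
    have hQ1 : ratioStability t a b 1 ≤ 0 := by
      rw [ratioStability_one ha hb]
      exact mul_nonpos_of_nonpos_of_nonneg (by linarith) (by positivity)
    rw [← hsing 1 rfl]
    refine BLYhat_inter_posAxis_eq_singleton one_pos ?_ fun p hp hp1 => ?_
    · have := not_eventually_forall_ne_zero_one ht0 hb0 hk0 ha hab (hparab h9) hQ1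
      exact not_not.1 fun h => this ((hmem 1 one_pos).1 h)
    · rw [hmem p hp]
      rcases ht0.eq_or_lt with rfl | ht
      · have ha' : a = 0 := by rw [ha, mul_zero]
        have hb' : b = 1 := by rw [hb, mul_zero, add_zero]
        subst ha' hb'
        rcases lt_or_gt_of_ne hp1 with h | h
        · exact eventually_forall_ne_zero_of_lt_one hk0 hp h
        · have hanti := ratioOrbit_antitone le_rfl le_rfl one_pos hab hd hp h.le
          obtain ⟨w, hw⟩ : ∃ w, Filter.Tendsto (ratioOrbit 0 0 1 p) Filter.atTop (nhds w) :=
            ⟨_, tendsto_atTop_ciInf hanti ⟨0, Set.forall_mem_range.2 fun n =>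
              (ratioOrbit_pos le_rfl le_rfl one_pos hp n).le⟩⟩
          obtain ⟨hw0, hfix⟩ := fixedPoint_of_tendsto_ratioOrbit le_rfl le_rfl one_pos hp hw
          have hw1 : w ≤ 1 := hanti.le_of_tendsto hw 0
          have : w * (p - w) = 0 := by linear_combination hfix
          have hw' : w = 0 := (mul_eq_zero.1 this).resolve_right (by linarith)
          refine eventually_forall_ne_zero_of_attracting le_rfl le_rfl one_pos hk0 hab hd hp hw ?_
          rw [hw']
          linarith
      · refine eventually_forall_ne_zero_of_regular ht hk1 ha hb hd hp (fun h => absurd h hp1)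
          fun _ _ w hw1 _ hw3 hQ => ?_
        have e : ratioStability t a b 1 - ratioStability t a b w =
            (w - 1) * (b - 3 * (t * a) - t * (1 + w)) := by
          simp only [ratioStability]
          ring
        have h3 : 0 < b - 3 * (t * a) - t * (1 + w) := by nlinarith
        have := mul_pos (sub_pos.2 hw1) h3
        linarith
  · have h1 : 1 < (k + 2) * t := not_le.1 h1
    have ht : 0 < t := ht0.lt_of_ne fun h => by
      rw [← h] at h1
      linarith
    have ha1 : 0 < a := by rw [ha]; positivity
    have hQ1 : 0 < ratioStability t a b 1 := by
      rw [ratioStability_one ha hb]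
      exact mul_pos (by linarith) (by positivity)
    have hS : 0 ≤ (b - t * a) * (b - 9 * (t * a)) := mul_nonneg (by linarith) (by linarith)
    have hs := Real.sq_sqrt hS
    have hs0 := Real.sqrt_nonneg ((b - t * a) * (b - 9 * (t * a)))
    rw [calZ_eq ha hb h2]
    obtain ⟨hw0, hQ, hZ⟩ := double_root_parameter ht ha1 hb0 h2 hs
    rw [hZ]
    set s := √((b - t * a) * (b - 9 * (t * a))) with hs'
    set w := (b - 3 * (t * a) - s) / (2 * t) with hw
    have hsw : 2 * (t * w) = b - 3 * (t * a) - s := by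
      rw [hw]
      field_simp
    have h3t : 3 * t ≤ b := by
      by_contra! h3
      have h4 : 3 * (k * t) * t < 1 * t := by
        rw [ha] at h2
        linarith
      have h5 : 3 * (k * t) < 1 := lt_of_mul_lt_mul_right h4 ht.le
      nlinarith
    have e : ∀ v, t * (ratioStability t a b v - ratioStability t a b w) =
        (t * v - t * w) * (t * v - t * w - s) := by
      intro v
      simp only [ratioStability]
      linear_combination (t * v - t * w) * hsw
    have hw1 : 1 ≤ w := by
      by_contra! h
      have h3 := e 1
      rw [hQ, sub_zero] at h3
      have h4 : 0 < t - t * w := by nlinarith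
      have h5 : t - t * w - s ≤ 0 := by linarith
      have h6 := mul_pos ht hQ1
      have h7 := mul_nonpos_of_nonneg_of_nonpos h4.le h5
      rw [mul_one] at h3
      linarith
    have hwb : 3 * t * w ≤ b := by
      have h4 : b - 9 * (t * a) ≤ 3 * s := by
        refine le_trans ?_ (le_mul_of_one_le_left hs0 (by norm_num : (1 : ℝ) ≤ 3))
        refine Real.le_sqrt_of_sq_le ?_
        have : 0 ≤ t * a := by positivity
        nlinarith
      linarith
    have hp : 0 < (w + a) ^ 2 / (w * (t * w + b) ^ 2) := by positivity
    refine BLYhat_inter_posAxis_eq_singleton hp ?_ fun p hp' hne => ?_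
    · have := not_eventually_forall_ne_zero_parabolic ht hb0 hk0 ha hab (hparab h2) hp hw1
        (by field_simp) hQ hwb
      exact not_not.1 fun h => this ((hmem _ hp).1 h)
    · rw [hmem p hp']
      refine eventually_forall_ne_zero_of_regular ht hk1 ha hb hd hp' (fun _ => hQ1)
        fun _ _ v hv1 hfix hv3 hQv => hne ?_
      have h3 := e v
      rw [hQ, hQv, sub_zero, mul_zero] at h3
      have hv : t * v = t * w := by
        rcases mul_eq_zero.1 h3.symm with h | h
        · linarith
        · have h4 : t * v ≤ t * (3 * a) := by gcongr
          linarith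
      rw [← mul_left_cancel₀ ht.ne' hv, eq_div_iff (by positivity)]
      linarith
  · have h2 : b < 9 * (t * a) := not_le.1 h2
    have ht : 0 < t := ht0.lt_of_ne fun h => by
      rw [← h] at h2
      linarith
    have ha1 : 0 < a := by rw [ha]; positivity
    rw [Set.eq_empty_iff_forall_notMem]
    rintro _ ⟨hz, p, hp, rfl⟩
    revert hz
    rw [imp_false, hmem p hp]
    exact eventually_forall_ne_zero_of_regular ht hk1 ha hb hd hp
      (fun _ => ratioStability_pos ht ha1 hd h2 one_pos) fun _ h => absurd h (by linarith)
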